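/- arXiv:2511.05087 — 2 statements merged into one kernel-verified Lean document; each statement's English description precedes it below -/
import Mathlib

section
/- Let H = 3/4, so β = 2H−2 = −1/2. Define L₂(T) = ∫₀^T e^{−t₁} (∫_{[0,t₁]³} e^{s₁−|t₂−s₂|} (t₁−t₂)^{−1/2} |s₁−s₂|^{−1/2} dt₂ ds₁ ds₂) dt₁. Then, as T → ∞, L₂(T) = 2·[(T−1)·log T + (c + (π−3)/2)·T + 1 − c − 13π/16 + 1/T] + O(T^{−2}), where c = 2·log 2 + γ and γ is the Euler–Mascheroni constant. -/
open Real MeasureTheory intervalIntegral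

noncomputable def L2 (β T : ℝ) : ℝ :=
  ∫ t₁ in (0:ℝ)..T, Real.exp (-t₁) *
    ∫ t₂ in (0:ℝ)..t₁, ∫ s₁ in (0:ℝ)..t₁, ∫ s₂ in (0:ℝ)..t₁,
      Real.exp (s₁ - |t₂ - s₂|) * (t₁ - t₂) ^ β * |s₁ - s₂| ^ β

section

open Set Filter Topology

theorem lintegral_triangle_swap {F : ℝ → ℝ → ENNReal} (hF : Measurable (Function.uncurry F))
    (x : ℝ) :
    ∫⁻ y in Ioo 0 x, ∫⁻ z in Ioo 0 y, F y z = ∫⁻ z in Ioo 0 x, ∫⁻ y in Ioo z x, F y z := by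
  have hS : MeasurableSet {p : ℝ × ℝ | 0 < p.2 ∧ p.2 < p.1 ∧ p.1 < x} :=
    (measurableSet_lt measurable_const measurable_snd).inter
      ((measurableSet_lt measurable_snd measurable_fst).inter
        (measurableSet_lt measurable_fst measurable_const))
  have hG := hF.indicator hS
  have key := lintegral_lintegral_swap (μ := (volume : Measure ℝ)) (ν := (volume : Measure ℝ))
    (f := fun y z => indicator {p : ℝ × ℝ | 0 < p.2 ∧ p.2 < p.1 ∧ p.1 < x}
      (Function.uncurry F) (y, z)) hG.aemeasurable
  convert key using 1
  · rw [← lintegral_indicator measurableSet_Ioo]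
    refine lintegral_congr fun y => ?_
    by_cases hy : y ∈ Ioo 0 x
    · rw [indicator_of_mem hy, ← lintegral_indicator measurableSet_Ioo]
      refine lintegral_congr fun z => ?_
      simp only [indicator, mem_Ioo, mem_ofPred_eq, Function.uncurry] at hy ⊢
      split_ifs <;> grind
    · rw [indicator_of_notMem hy, eq_comm, lintegral_eq_zero_of_ae_eq_zero]
      refine Filter.Eventually.of_forall fun z => ?_
      simp only [indicator, mem_Ioo, mem_ofPred_eq, Pi.zero_apply] at hy ⊢
      exact if_neg (by grind)
  · rw [← lintegral_indicator measurableSet_Ioo]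
    refine lintegral_congr fun z => ?_
    by_cases hz : z ∈ Ioo 0 x
    · rw [indicator_of_mem hz, ← lintegral_indicator measurableSet_Ioo]
      refine lintegral_congr fun y => ?_
      simp only [indicator, mem_Ioo, mem_ofPred_eq, Function.uncurry] at hz ⊢
      split_ifs <;> grind
    · rw [indicator_of_notMem hz, eq_comm, lintegral_eq_zero_of_ae_eq_zero]
      refine Filter.Eventually.of_forall fun y => ?_
      simp only [indicator, mem_Ioo, mem_ofPred_eq, Pi.zero_apply] at hz ⊢
      exact if_neg (by grind)

theorem measurable_lintegral_Ioo {F : ℝ → ℝ → ENNReal} (hF : Measurable (Function.uncurry F)) :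
    Measurable fun y => ∫⁻ z in Ioo 0 y, F y z := by
  have hS : MeasurableSet {p : ℝ × ℝ | 0 < p.2 ∧ p.2 < p.1} :=
    (measurableSet_lt measurable_const measurable_snd).inter
      (measurableSet_lt measurable_snd measurable_fst)
  have := (hF.indicator hS).lintegral_prod_right' (ν := (volume : Measure ℝ))
  convert this using 2 with y
  rw [← lintegral_indicator measurableSet_Ioo]
  exact lintegral_congr fun z => by simp [indicator, Function.uncurry]

theorem lintegral_square {F : ℝ → ℝ → ENNReal} (hF : Measurable (Function.uncurry F)) (x : ℝ) :
    ∫⁻ y in Ioo 0 x, ∫⁻ z in Ioo 0 x, F y z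
      = ∫⁻ y in Ioo 0 x, ∫⁻ z in Ioo 0 y, (F y z + F z y) := by
  have hF' : Measurable (Function.uncurry fun y z => F z y) := hF.comp measurable_swap
  have h1 : ∀ y ∈ Ioo 0 x, ∫⁻ z in Ioo 0 x, F y z
      = (∫⁻ z in Ioo 0 y, F y z) + ∫⁻ z in Ioo y x, F y z := by
    intro y hy
    rw [← Ioc_union_Ioo_eq_Ioo hy.1.le hy.2, lintegral_union measurableSet_Ioo
      (by rw [Set.disjoint_left]; intro a ha hb; exact absurd hb.1 (not_lt.2 ha.2)),
      Measure.restrict_congr_set (Ioo_ae_eq_Ioc (a := 0) (b := y))]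
  rw [setLIntegral_congr_fun measurableSet_Ioo h1, lintegral_add_left
    (measurable_lintegral_Ioo hF), ← lintegral_triangle_swap (F := fun y z => F z y) hF',
    ← lintegral_add_left (measurable_lintegral_Ioo hF)]
  refine lintegral_congr fun y => ?_
  rw [lintegral_add_left hF.of_uncurry_left]

theorem lintegral_cube {F : ℝ → ℝ → ℝ → ENNReal}
    (hF : Measurable fun p : ℝ × ℝ × ℝ => F p.1 p.2.1 p.2.2) (t : ℝ) :
    ∫⁻ v in Ioo 0 t, ∫⁻ u in Ioo 0 t, ∫⁻ w in Ioo 0 t, F v u w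
      = ∫⁻ x in Ioo 0 t, ((∫⁻ u in Ioo 0 x, ∫⁻ w in Ioo 0 x, F x u w)
        + ((∫⁻ v in Ioo 0 x, ∫⁻ w in Ioo 0 x, F v x w)
        + ∫⁻ v in Ioo 0 x, ∫⁻ u in Ioo 0 x, F v u x)) := by
  have hs : ∀ v, Measurable (Function.uncurry (F v)) := fun v =>
    hF.comp (measurable_const.prodMk measurable_id)
  have hS : MeasurableSet {p : (ℝ × ℝ) × ℝ | 0 < p.2 ∧ p.2 < p.1.2} :=
    (measurableSet_lt measurable_const measurable_snd).inter
      (measurableSet_lt measurable_snd (measurable_snd.comp measurable_fst))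
  have hG : Measurable (fun p : (ℝ × ℝ) × ℝ => F p.1.1 p.1.2 p.2 + F p.1.1 p.2 p.1.2) := by
    refine Measurable.add ?_ ?_
    · exact hF.comp (f := fun p : (ℝ × ℝ) × ℝ => (p.1.1, p.1.2, p.2)) (by fun_prop)
    · exact hF.comp (f := fun p : (ℝ × ℝ) × ℝ => (p.1.1, p.2, p.1.2)) (by fun_prop)
  have hg : Measurable (Function.uncurry fun v y : ℝ =>
      ∫⁻ z in Ioo 0 y, (F v y z + F v z y)) := by
    have := (hG.indicator hS).lintegral_prod_right' (ν := (volume : Measure ℝ))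
    convert this using 2 with p
    rw [Function.uncurry, ← lintegral_indicator measurableSet_Ioo]
    exact lintegral_congr fun z => by simp [indicator]
  calc _ = ∫⁻ v in Ioo 0 t, ∫⁻ y in Ioo 0 t, ∫⁻ z in Ioo 0 y, (F v y z + F v z y) :=
        lintegral_congr fun v => lintegral_square (hs v) t
    _ = _ := by
      rw [lintegral_square hg]
      refine lintegral_congr fun x => ?_
      rw [lintegral_add_left hg.of_uncurry_left, ← lintegral_square (hs x)]
      congr 1
      have h2 : Measurable fun v => ∫⁻ z in Ioo 0 x, F v x z := by
        refine Measurable.lintegral_prod_right' (f := fun p : ℝ × ℝ => F p.1 x p.2) ?_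
        exact hF.comp (f := fun p : ℝ × ℝ => (p.1, x, p.2)) (by fun_prop)
      rw [← lintegral_add_left h2]
      refine lintegral_congr fun v => ?_
      rw [lintegral_add_left]
      exact hF.comp (f := fun z : ℝ => (v, x, z)) (by fun_prop)

theorem lintegral_Ioo_comp_sub (F : ℝ → ENNReal) (y : ℝ) :
    ∫⁻ z in Ioo 0 y, F z = ∫⁻ d in Ioo 0 y, F (y - d) := by
  rw [← lintegral_indicator measurableSet_Ioo, ← lintegral_indicator measurableSet_Ioo,
    ← lintegral_sub_left_eq_self _ y]
  refine lintegral_congr fun d => ?_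
  simp only [indicator, mem_Ioo]
  exact if_congr (by grind) rfl rfl

theorem lintegral_Ioo_ofReal_deriv {F f : ℝ → ℝ} {a b : ℝ} (hab : a ≤ b)
    (hc : ContinuousOn F (Icc a b)) (hd : ∀ x ∈ Ioo a b, HasDerivAt F (f x) x)
    (hf : ∀ x ∈ Ioo a b, 0 ≤ f x) :
    ∫⁻ x in Ioo a b, ENNReal.ofReal (f x) = ENNReal.ofReal (F b - F a) := by
  have hi : IntegrableOn f (Ioc a b) := integrableOn_deriv_of_nonneg hc hd hf
  have hii : IntervalIntegrable f volume a b :=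
    (intervalIntegrable_iff_integrableOn_Ioc_of_le hab).2 hi
  rw [← integral_eq_sub_of_hasDerivAt_of_le hab hc hd hii, integral_of_le hab,
    integral_Ioc_eq_integral_Ioo,
    ofReal_integral_eq_lintegral_ofReal (hi.mono_set Ioo_subset_Ioc_self)]
  exact (ae_restrict_iff' measurableSet_Ioo).2 (Filter.Eventually.of_forall hf)

theorem le_of_hasDerivAt_nonneg {F f : ℝ → ℝ} {a b : ℝ} (hab : a ≤ b)
    (hc : ContinuousOn F (Icc a b)) (hd : ∀ x ∈ Ioo a b, HasDerivAt F (f x) x)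
    (hf : ∀ x ∈ Ioo a b, 0 ≤ f x) : F a ≤ F b := by
  refine monotoneOn_of_deriv_nonneg (convex_Icc a b) hc ?_ ?_ (left_mem_Icc.2 hab)
    (right_mem_Icc.2 hab) hab
  · rw [interior_Icc]
    exact fun x hx => (hd x hx).differentiableAt.differentiableWithinAt
  · rw [interior_Icc]
    exact fun x hx => (hd x hx).deriv ▸ hf x hx

theorem integral_integral_integral_eq_toReal {k : ℝ → ℝ → ℝ → ℝ}
    (hk : Measurable fun p : ℝ × ℝ × ℝ => k p.1 p.2.1 p.2.2) (h0 : ∀ v u w, 0 ≤ k v u w)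
    {t : ℝ} (ht : 0 ≤ t)
    (hfin : ∫⁻ v in Ioo 0 t, ∫⁻ u in Ioo 0 t, ∫⁻ w in Ioo 0 t, ENNReal.ofReal (k v u w) ≠ ⊤) :
    ∫ v in 0..t, ∫ u in 0..t, ∫ w in 0..t, k v u w
      = (∫⁻ v in Ioo 0 t, ∫⁻ u in Ioo 0 t, ∫⁻ w in Ioo 0 t, ENNReal.ofReal (k v u w)).toReal := by
  simp only [integral_of_le ht, integral_Ioc_eq_integral_Ioo]
  have hk2 : Measurable fun p : (ℝ × ℝ) × ℝ => ENNReal.ofReal (k p.1.1 p.1.2 p.2) :=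
    (hk.comp (f := fun p : (ℝ × ℝ) × ℝ => (p.1.1, p.1.2, p.2)) (by fun_prop)).ennreal_ofReal
  have hJ : Measurable fun p : ℝ × ℝ => ∫⁻ w in Ioo 0 t, ENNReal.ofReal (k p.1 p.2 w) :=
    hk2.lintegral_prod_right'
  have hK : Measurable fun v => ∫⁻ u in Ioo 0 t, ∫⁻ w in Ioo 0 t, ENNReal.ofReal (k v u w) :=
    hJ.lintegral_prod_right'
  have h1 : ∀ v u, ∫ w in Ioo 0 t, k v u w
      = (∫⁻ w in Ioo 0 t, ENNReal.ofReal (k v u w)).toReal := fun v u =>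
    integral_eq_lintegral_of_nonneg_ae (Filter.Eventually.of_forall (h0 v u))
      (hk.comp (f := fun w : ℝ => (v, u, w)) (by fun_prop)).aestronglyMeasurable
  have hKfin := ae_lt_top hK hfin
  simp only [h1]
  rw [← integral_toReal hK.aemeasurable hKfin]
  refine integral_congr_ae ?_
  filter_upwards [hKfin] with v hv
  have hJv : Measurable fun u => ∫⁻ w in Ioo 0 t, ENNReal.ofReal (k v u w) :=
    hJ.comp (f := fun u : ℝ => (v, u)) (by fun_prop)
  exact integral_toReal hJv.aemeasurable (ae_lt_top hJv hv.ne)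

noncomputable def expSqMean (z : ℝ) : ℝ := ∫ s in (0:ℝ)..1, 2 * exp (z * s ^ 2)

theorem continuous_expSqMean : Continuous expSqMean := by
  unfold expSqMean
  exact continuous_parametric_intervalIntegral_of_continuous' (by fun_prop) 0 1

theorem sqrt_mul_expSqMean (ε x : ℝ) (hx : 0 ≤ x) :
    √x * expSqMean (ε * x) = ∫ r in (0:ℝ)..√x, 2 * exp (ε * r ^ 2) := by
  have h := mul_integral_comp_mul_left (a := 0) (b := 1) (f := fun r => 2 * exp (ε * r ^ 2)) (√x)
  rw [mul_zero, mul_one] at h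
  rw [← h, expSqMean]
  congr 1
  refine integral_congr fun s _ => ?_
  simp only [mul_pow, sq_sqrt hx, mul_assoc]

theorem hasDerivAt_sqrt_mul_expSqMean (ε : ℝ) {x : ℝ} (hx : 0 < x) :
    HasDerivAt (fun x => √x * expSqMean (ε * x)) (exp (ε * x) * (√x)⁻¹) x := by
  have hc : Continuous fun r : ℝ => 2 * exp (ε * r ^ 2) := by fun_prop
  have h1 := (hc.integral_hasStrictDerivAt 0 (√x)).hasDerivAt
  have h2 := h1.comp x (hasDerivAt_sqrt hx.ne')
  have h3 : HasDerivAt (fun x => √x * expSqMean (ε * x))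
      (2 * exp (ε * (√x) ^ 2) * (1 / (2 * √x))) x := by
    refine h2.congr_of_eventuallyEq ?_
    filter_upwards [lt_mem_nhds hx] with y hy using sqrt_mul_expSqMean ε y hy.le
  refine h3.congr_deriv ?_
  rw [sq_sqrt hx.le]
  have := sqrt_pos.2 hx
  field_simp

/-- `D(x) = ∫₀¹ 2 exp(-x(1 - s²)) ds`, which is `x^{-1/2} ∫₀ˣ e^{-u} (x - u)^{-1/2} du` for
positive `x`. -/
noncomputable def dawson (x : ℝ) : ℝ := exp (-x) * expSqMean x

theorem continuous_dawson : Continuous dawson :=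
  (by fun_prop : Continuous fun x : ℝ => exp (-x)).mul continuous_expSqMean

theorem hasDerivAt_expSqMean (ε : ℝ) {x : ℝ} (hx : 0 < x) :
    HasDerivAt (fun x => expSqMean (ε * x)) (exp (ε * x) / x - expSqMean (ε * x) / (2 * x)) x := by
  have hs := sqrt_pos.2 hx
  have h := (hasDerivAt_sqrt_mul_expSqMean ε hx).div (hasDerivAt_sqrt hx.ne') hs.ne'
  refine HasDerivAt.congr_deriv (h.congr_of_eventuallyEq ?_) ?_
  · filter_upwards [lt_mem_nhds hx] with y hy
    have := sqrt_pos.2 hy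
    simp only [Pi.div_apply]
    field_simp
  have h4 : (√x) ^ 2 = x := sq_sqrt hx.le
  field_simp
  rw [h4]

theorem hasDerivAt_dawson {x : ℝ} (hx : 0 < x) :
    HasDerivAt dawson (1 / x - dawson x - dawson x / (2 * x)) x := by
  have h1 : HasDerivAt (fun x : ℝ => exp (-x)) (-exp (-x)) x := by
    simpa using (hasDerivAt_neg x).exp
  have h2 := hasDerivAt_expSqMean 1 hx
  simp only [one_mul] at h2
  refine (h1.mul h2).congr_deriv ?_
  have : exp (-x) * exp x = 1 := by rw [← exp_add]; simp
  unfold dawson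
  field_simp
  linear_combination 2 * this

/-- `N(x) = ∫₀¹ 2 exp(-x s²) ds`, which is `x^{-1/2} ∫₀ˣ e^{-s} s^{-1/2} ds` for positive `x`. -/
noncomputable def gaussMean (x : ℝ) : ℝ := expSqMean (-x)

theorem continuous_gaussMean : Continuous gaussMean := continuous_expSqMean.comp continuous_neg

theorem hasDerivAt_gaussMean {x : ℝ} (hx : 0 < x) :
    HasDerivAt gaussMean (exp (-x) / x - gaussMean x / (2 * x)) x := by
  have h := hasDerivAt_expSqMean (-1) hx
  simp only [neg_one_mul] at h
  exact h

/-- The angular density `π + 2 arcsin ((1 - y) / (1 + y))`. -/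
noncomputable def angle (y : ℝ) : ℝ := π + 2 * arcsin ((1 - y) / (1 + y))

theorem continuousOn_angle : ContinuousOn angle (Ici 0) := by
  unfold angle
  refine continuousOn_const.add (continuousOn_const.mul (continuous_arcsin.comp_continuousOn ?_))
  refine ContinuousOn.div (by fun_prop) (by fun_prop) fun y hy => ?_
  have : (0:ℝ) ≤ y := hy
  positivity

theorem angle_nonneg (y : ℝ) : 0 ≤ angle y := by
  unfold angle; linarith [neg_pi_div_two_le_arcsin ((1 - y) / (1 + y))]

theorem angle_le (y : ℝ) : angle y ≤ 2 * π := by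
  unfold angle; linarith [arcsin_le_pi_div_two ((1 - y) / (1 + y))]

theorem hasDerivAt_angle {y : ℝ} (hy : y ∈ Ioo (0:ℝ) 1) :
    HasDerivAt angle (-2 / (√y * (1 + y))) y := by
  have hy0 := hy.1
  have hs := sqrt_pos.2 hy0
  have h4 : (√y) ^ 2 = y := sq_sqrt hy0.le
  have hin : HasDerivAt (fun y : ℝ => (1 - y) / (1 + y))
      (((-1) * (1 + y) - (1 - y) * 1) / (1 + y) ^ 2) y :=
    ((hasDerivAt_id y).const_sub 1).div ((hasDerivAt_id y).const_add 1) (by positivity)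
  have hz1 : (1 - y) / (1 + y) ≠ -1 := by
    intro h; field_simp at h; linarith
  have hz2 : (1 - y) / (1 + y) ≠ 1 := by
    intro h; field_simp at h; linarith
  have h := (((hasDerivAt_arcsin hz1 hz2).comp y hin).const_mul 2).const_add π
  have e : √(1 - ((1 - y) / (1 + y)) ^ 2) = 2 * √y / (1 + y) := by
    rw [sqrt_eq_iff_eq_sq (by
      have : 1 - ((1 - y) / (1 + y)) ^ 2 = 4 * y / (1 + y) ^ 2 := by field_simp; ring
      rw [this]; positivity) (by positivity), div_pow (2 * √y), mul_pow, h4]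
    field_simp; ring
  refine h.congr_deriv ?_
  rw [e]
  field_simp
  ring

/-- `ρ(x) = x ∫₀¹ exp(-x(1 + y)) angle(y) dy`. -/
noncomputable def rho (x : ℝ) : ℝ := ∫ y in (0:ℝ)..1, x * exp (-(x * (1 + y))) * angle y

/-- The density of `∂ₜ` of the triple integral. -/
noncomputable def phi (x : ℝ) : ℝ :=
  x * dawson x ^ 2 + (x + 1 / 2) * dawson x - 1 + (x - 1 / 2) * exp (-x) * gaussMean x
    + exp (-(2 * x)) + rho x

/-- The integrand after the substitution `u = t₁ - s₁`, `v = t₁ - t₂`, `w = t₁ - s₂`. -/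
noncomputable def kern (v u w : ℝ) : ℝ :=
  exp (-u) * exp (-|v - w|) * (√v)⁻¹ * (√|u - w|)⁻¹

theorem kern_nonneg (v u w : ℝ) : 0 ≤ kern v u w := by unfold kern; positivity

theorem measurable_kern : Measurable fun p : ℝ × ℝ × ℝ => kern p.1 p.2.1 p.2.2 := by
  unfold kern; fun_prop

theorem continuous_sqrt_mul_expSqMean (ε : ℝ) : Continuous fun x => √x * expSqMean (ε * x) :=
  continuous_sqrt.mul (continuous_expSqMean.comp (continuous_const.mul continuous_id))

theorem expSqMean_nonneg (z : ℝ) : 0 ≤ expSqMean z :=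
  integral_nonneg zero_le_one fun _ _ => by positivity

theorem dawson_nonneg (x : ℝ) : 0 ≤ dawson x := mul_nonneg (exp_pos _).le (expSqMean_nonneg _)

theorem lintegral_kern_last {x : ℝ} (hx : 0 < x) :
    ∫⁻ v in Ioo 0 x, ∫⁻ u in Ioo 0 x, ENNReal.ofReal (kern v u x)
      = ENNReal.ofReal (x * dawson x ^ 2) := by
  have hV := continuous_sqrt_mul_expSqMean 1
  have h1 : ∀ v ∈ Ioo 0 x, ∫⁻ u in Ioo 0 x, ENNReal.ofReal (kern v u x)
      = ENNReal.ofReal (√x * dawson x * (exp (-x) * (exp (1 * v) * (√v)⁻¹))) := by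
    intro v hv
    rw [lintegral_Ioo_ofReal_deriv
      (F := fun u => -(exp (-x) * exp (-(x - v)) * (√v)⁻¹ *
        (√(x - u) * expSqMean (1 * (x - u))))) hx.le ?_ ?_ fun u _ => kern_nonneg _ _ _]
    · congr 1
      have : exp (-(x - v)) = exp (-x) * exp v := by rw [← exp_add]; ring_nf
      simp only [sub_self, sqrt_zero, sub_zero, one_mul, zero_mul, mul_zero, dawson]
      rw [this]; ring
    · refine ContinuousOn.neg (continuousOn_const.mul (Continuous.continuousOn ?_))
      exact hV.comp (continuous_const.sub continuous_id)
    · intro u hu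
      have h := hasDerivAt_sqrt_mul_expSqMean 1 (sub_pos.2 hu.2)
      have h2 := ((h.comp u ((hasDerivAt_id u).const_sub x)).const_mul
        (exp (-x) * exp (-(x - v)) * (√v)⁻¹)).neg
      refine h2.congr_deriv ?_
      have e1 : |v - x| = x - v := by rw [abs_sub_comm, abs_of_pos (sub_pos.2 hv.2)]
      have e2 : |u - x| = x - u := by rw [abs_sub_comm, abs_of_pos (sub_pos.2 hu.2)]
      have e3 : exp (-u) = exp (-x) * exp (1 * (x - u)) := by rw [← exp_add]; ring_nf
      rw [kern, e1, e2, e3]; ring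
  rw [setLIntegral_congr_fun measurableSet_Ioo h1, lintegral_Ioo_ofReal_deriv
    (F := fun v => √x * dawson x * (exp (-x) * (√v * expSqMean (1 * v)))) hx.le
    (continuous_const.mul (continuous_const.mul hV)).continuousOn
    (fun v hv => ((hasDerivAt_sqrt_mul_expSqMean 1 hv.1).const_mul _).const_mul _)
    (fun v _ => mul_nonneg (mul_nonneg (sqrt_nonneg _) (dawson_nonneg _)) (by positivity))]
  congr 1
  have h4 : (√x) ^ 2 = x := sq_sqrt hx.le
  simp only [sqrt_zero, one_mul, zero_mul, mul_zero, sub_zero, dawson]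
  linear_combination (rexp (-x) * expSqMean x) ^ 2 * h4

theorem lintegral_kern_first {x : ℝ} (hx : 0 < x) :
    0 ≤ (x + 1 / 2) * dawson x - 1 + (x - 1 / 2) * exp (-x) * gaussMean x + exp (-(2 * x)) ∧
    ∫⁻ u in Ioo 0 x, ∫⁻ w in Ioo 0 x, ENNReal.ofReal (kern x u w)
      = ENNReal.ofReal ((x + 1 / 2) * dawson x - 1 + (x - 1 / 2) * exp (-x) * gaussMean x
        + exp (-(2 * x))) := by
  have hV := continuous_sqrt_mul_expSqMean 1
  have hV' := continuous_sqrt_mul_expSqMean (-1)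
  have hs := sqrt_pos.2 hx
  have h4 : (√x) ^ 2 = x := sq_sqrt hx.le
  rw [lintegral_square (F := fun u w => ENNReal.ofReal (kern x u w)) (by
    exact (measurable_kern.comp (f := fun p : ℝ × ℝ => (x, p.1, p.2)) (by fun_prop)).ennreal_ofReal)]
  have h1 : ∀ y ∈ Ioo 0 x,
      ∫⁻ z in Ioo 0 y, (ENNReal.ofReal (kern x y z) + ENNReal.ofReal (kern x z y))
      = ENNReal.ofReal (exp (-x) * (√x)⁻¹ * (√y * expSqMean (1 * y) + √y * expSqMean (-1 * y))) := by
    intro y hy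
    simp only [← ENNReal.ofReal_add (kern_nonneg _ _ _) (kern_nonneg _ _ _)]
    rw [lintegral_Ioo_ofReal_deriv
      (F := fun z => -(exp (-x) * (√x)⁻¹ * (√(y - z) * expSqMean (1 * (y - z))
        + √(y - z) * expSqMean (-1 * (y - z))))) hy.1.le ?_ ?_
        fun u _ => add_nonneg (kern_nonneg _ _ _) (kern_nonneg _ _ _)]
    · congr 1
      simp
    · refine ContinuousOn.neg (continuousOn_const.mul (Continuous.continuousOn ?_))
      exact (hV.add hV').comp (continuous_const.sub continuous_id)
    · intro z hz
      have h := (hasDerivAt_sqrt_mul_expSqMean 1 (sub_pos.2 hz.2)).add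
        (hasDerivAt_sqrt_mul_expSqMean (-1) (sub_pos.2 hz.2))
      have h2 := ((h.comp z ((hasDerivAt_id z).const_sub y)).const_mul
        (exp (-x) * (√x)⁻¹)).neg
      refine h2.congr_deriv ?_
      have e1 : |x - z| = x - z := abs_of_pos (sub_pos.2 (hz.2.trans hy.2))
      have e2 : |y - z| = y - z := abs_of_pos (sub_pos.2 hz.2)
      have e3 : |x - y| = x - y := abs_of_pos (sub_pos.2 hy.2)
      have e4 : |z - y| = y - z := by rw [abs_sub_comm, e2]
      have e5 : exp (-y) * exp (-(x - z)) = exp (-x) * exp (-1 * (y - z)) := by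
        rw [← exp_add, ← exp_add]; ring_nf
      have e6 : exp (-z) * exp (-(x - y)) = exp (-x) * exp (1 * (y - z)) := by
        rw [← exp_add, ← exp_add]; ring_nf
      rw [kern, kern, e1, e2, e3, e4, e5, e6]; ring
  have hc : ContinuousOn (fun y => exp (-x) * (√x)⁻¹ * ((y + 1 / 2) * (√y * expSqMean (1 * y))
      - √y * exp (1 * y) + (y - 1 / 2) * (√y * expSqMean (-1 * y)) + √y * exp (-1 * y)))
      (Icc 0 x) := by
    refine Continuous.continuousOn (continuous_const.mul
      (((Continuous.sub (Continuous.mul ?_ hV) ?_).add (Continuous.mul ?_ hV')).add ?_)) <;>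
      fun_prop
  have hd : ∀ y ∈ Ioo 0 x, HasDerivAt
      (fun y => exp (-x) * (√x)⁻¹ * ((y + 1 / 2) * (√y * expSqMean (1 * y)) - √y * exp (1 * y)
        + (y - 1 / 2) * (√y * expSqMean (-1 * y)) + √y * exp (-1 * y)))
      (exp (-x) * (√x)⁻¹ * (√y * expSqMean (1 * y) + √y * expSqMean (-1 * y))) y := by
    intro y hy
    have hsy := sqrt_pos.2 hy.1
    have h5 : (√y) ^ 2 = y := sq_sqrt hy.1.le
    have d1 := ((hasDerivAt_id y).add_const (1 / 2)).mul (hasDerivAt_sqrt_mul_expSqMean 1 hy.1)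
    have d2 := (hasDerivAt_sqrt hy.1.ne').mul ((hasDerivAt_id y).const_mul (1:ℝ)).exp
    have d3 := ((hasDerivAt_id y).sub_const (1 / 2)).mul (hasDerivAt_sqrt_mul_expSqMean (-1) hy.1)
    have d4 := (hasDerivAt_sqrt hy.1.ne').mul ((hasDerivAt_id y).const_mul (-1:ℝ)).exp
    refine ((((d1.sub d2).add d3).add d4).const_mul (exp (-x) * (√x)⁻¹)).congr_deriv ?_
    simp only [id]
    field_simp
    rw [h5]
    ring
  have hf : ∀ y ∈ Ioo 0 x,
      0 ≤ exp (-x) * (√x)⁻¹ * (√y * expSqMean (1 * y) + √y * expSqMean (-1 * y)) := by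
    intro y hy
    have := expSqMean_nonneg (1 * y)
    have := expSqMean_nonneg (-1 * y)
    positivity
  have e : exp (-(2 * x)) = exp (-x) * exp (-x) := by rw [← exp_add]; ring_nf
  have e' : exp (-x) * exp x = 1 := by rw [← exp_add]; simp
  have hval : exp (-x) * (√x)⁻¹ * ((x + 1 / 2) * (√x * expSqMean (1 * x)) - √x * exp (1 * x)
      + (x - 1 / 2) * (√x * expSqMean (-1 * x)) + √x * exp (-1 * x))
      = (x + 1 / 2) * dawson x - 1 + (x - 1 / 2) * exp (-x) * gaussMean x + exp (-(2 * x)) := by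
    simp only [one_mul, dawson, gaussMean, e, neg_one_mul]
    rw [← e']
    field_simp
  have hmono := le_of_hasDerivAt_nonneg hx.le hc hd hf
  have hlint := lintegral_Ioo_ofReal_deriv hx.le hc hd hf
  simp only [hval, sqrt_zero, zero_mul, mul_zero, sub_zero, add_zero] at hmono hlint
  exact ⟨hmono, by rw [setLIntegral_congr_fun measurableSet_Ioo h1, hlint]⟩

theorem hasDerivAt_arcsin_affine {c y : ℝ} (hy : 0 < y) (hyc : y < c) :
    HasDerivAt (fun y => arcsin (2 * y / c - 1)) ((√y)⁻¹ * (√(c - y))⁻¹) y := by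
  have hc : 0 < c := hy.trans hyc
  have hcy : 0 < c - y := sub_pos.2 hyc
  have h1 : HasDerivAt (fun y : ℝ => 2 * y / c - 1) (2 * 1 / c) y :=
    (((hasDerivAt_id y).const_mul 2).div_const c).sub_const 1
  have hz1 : 2 * y / c - 1 ≠ -1 := by
    have : 0 < 2 * y / c := by positivity
    linarith
  have hz2 : 2 * y / c - 1 ≠ 1 := by
    have : 2 * y / c < 2 := by rw [div_lt_iff₀ hc]; linarith
    linarith
  refine ((hasDerivAt_arcsin hz1 hz2).comp y h1).congr_deriv ?_
  have : 1 - (2 * y / c - 1) ^ 2 = (2 / c) ^ 2 * (y * (c - y)) := by field_simp; ring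
  rw [this, sqrt_mul (by positivity), sqrt_sq (by positivity), sqrt_mul hy.le]
  field_simp

theorem rho_eq (x : ℝ) (hx : 0 < x) :
    rho x = exp (-x) * ∫ d in (0:ℝ)..x, exp (-d) * angle (d / x) := by
  have h := integral_comp_mul_left (a := 0) (b := 1) (fun d => exp (-d) * angle (d / x)) hx.ne'
  rw [mul_zero, mul_one] at h
  have h2 : ∫ d in (0:ℝ)..x, exp (-d) * angle (d / x)
      = x * ∫ y in (0:ℝ)..1, exp (-(x * y)) * angle (x * y / x) := by
    rw [h, smul_eq_mul, mul_inv_cancel_left₀ hx.ne']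
  rw [h2, rho, ← mul_assoc, ← intervalIntegral.integral_const_mul]
  refine integral_congr fun y _ => ?_
  have e : exp (-(x * (1 + y))) = exp (-x) * exp (-(x * y)) := by rw [← exp_add]; ring_nf
  simp only [mul_div_cancel_left₀ _ hx.ne', e]
  ring

theorem lintegral_kern_middle {x : ℝ} (hx : 0 < x) :
    ∫⁻ v in Ioo 0 x, ∫⁻ w in Ioo 0 x, ENNReal.ofReal (kern v x w) = ENNReal.ofReal (rho x) := by
  rw [lintegral_square (F := fun v w => ENNReal.ofReal (kern v x w)) (by
    exact (measurable_kern.comp (f := fun p : ℝ × ℝ => (p.1, x, p.2)) (by fun_prop)).ennreal_ofReal)]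
  have h1 : ∀ y ∈ Ioo 0 x,
      ∫⁻ z in Ioo 0 y, (ENNReal.ofReal (kern y x z) + ENNReal.ofReal (kern z x y))
      = ∫⁻ d in Ioo 0 y, ENNReal.ofReal (kern y x (y - d) + kern (y - d) x y) := by
    intro y hy
    simp only [← ENNReal.ofReal_add (kern_nonneg _ _ _) (kern_nonneg _ _ _)]
    exact lintegral_Ioo_comp_sub _ y
  rw [setLIntegral_congr_fun measurableSet_Ioo h1, lintegral_triangle_swap
    (F := fun y d => ENNReal.ofReal (kern y x (y - d) + kern (y - d) x y)) (by
      refine Measurable.ennreal_ofReal (Measurable.add ?_ ?_)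
      · exact measurable_kern.comp (f := fun p : ℝ × ℝ => (p.1, x, p.1 - p.2)) (by fun_prop)
      · exact measurable_kern.comp (f := fun p : ℝ × ℝ => (p.1 - p.2, x, p.1)) (by fun_prop))]
  have h2 : ∀ d ∈ Ioo 0 x,
      ∫⁻ y in Ioo d x, ENNReal.ofReal (kern y x (y - d) + kern (y - d) x y)
      = ENNReal.ofReal (exp (-x) * (exp (-d) * angle (d / x))) := by
    intro d hd
    have hd0 := hd.1
    have hxd : 0 < x - d := sub_pos.2 hd.2
    rw [lintegral_Ioo_ofReal_deriv
      (F := fun y => exp (-x) * exp (-d) * (arcsin (2 * y / (x + d) - 1)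
        + arcsin (2 * (y - d) / (x - d) - 1))) hd.2.le ?_ ?_
        fun u _ => add_nonneg (kern_nonneg _ _ _) (kern_nonneg _ _ _)]
    · congr 1
      have a1 : 2 * x / (x + d) - 1 = (1 - d / x) / (1 + d / x) := by field_simp; ring
      have a2 : 2 * d / (x + d) - 1 = -((1 - d / x) / (1 + d / x)) := by field_simp; ring
      have a3 : 2 * (x - d) / (x - d) - 1 = 1 := by field_simp; ring
      rw [a1, a2, a3, sub_self, mul_zero, zero_div, zero_sub, arcsin_neg, arcsin_neg, arcsin_one,
        angle]
      ring
    · refine Continuous.continuousOn (continuous_const.mul (Continuous.add ?_ ?_))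
      · exact continuous_arcsin.comp (by fun_prop)
      · exact continuous_arcsin.comp (by fun_prop)
    · intro y hy
      have hy0 : 0 < y := hd0.trans hy.1
      have d1 := hasDerivAt_arcsin_affine (c := x + d) hy0 (by linarith [hy.2])
      have d2 := (hasDerivAt_arcsin_affine (c := x - d) (sub_pos.2 hy.1)
        (by linarith [hy.2])).comp y ((hasDerivAt_id y).sub_const d)
      refine ((d1.add d2).const_mul (exp (-x) * exp (-d))).congr_deriv ?_
      have e1 : |y - (y - d)| = d := by rw [sub_sub_cancel, abs_of_pos hd0]
      have e2 : |y - d - y| = d := by rw [abs_sub_comm, e1]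
      have e3 : |x - (y - d)| = x + d - y := by rw [abs_of_pos] <;> linarith [hy.2]
      have e4 : |x - y| = x - y := abs_of_pos (sub_pos.2 hy.2)
      have e5 : x - d - (y - d) = x - y := by ring
      rw [kern, kern, e1, e2, e3, e4, e5]
      ring
  rw [setLIntegral_congr_fun measurableSet_Ioo h2, rho_eq x hx,
    ← intervalIntegral.integral_const_mul, integral_of_le hx.le, integral_Ioc_eq_integral_Ioo,
    ofReal_integral_eq_lintegral_ofReal]
  · refine IntegrableOn.mono_set (ContinuousOn.integrableOn_Icc ?_) Ioo_subset_Icc_self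
    refine continuousOn_const.mul (ContinuousOn.mul (by fun_prop) ?_)
    exact continuousOn_angle.comp (by fun_prop) fun d hd => div_nonneg hd.1 hx.le
  · exact Filter.Eventually.of_forall fun d => mul_nonneg (exp_pos _).le
      (mul_nonneg (exp_pos _).le (angle_nonneg _))

theorem continuous_rho : Continuous rho := by
  have : ∀ x, rho x = ∫ y in (0:ℝ)..1, x * exp (-(x * (1 + y))) * angle (max y 0) := fun x => by
    refine integral_congr fun y hy => ?_
    rw [uIcc_of_le zero_le_one] at hy
    simp only [max_eq_left hy.1]
  rw [funext this]
  refine continuous_parametric_intervalIntegral_of_continuous' ?_ 0 1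
  have h : Continuous fun y : ℝ => angle (max y 0) :=
    continuousOn_angle.comp_continuous (by fun_prop) fun y => mem_Ici.2 (le_max_right _ _)
  exact Continuous.mul (by fun_prop) (h.comp continuous_snd)

theorem continuous_phi : Continuous phi := by
  have h1 := continuous_dawson
  have h2 := continuous_gaussMean
  have h3 := continuous_rho
  unfold phi
  fun_prop

theorem rho_nonneg {x : ℝ} (hx : 0 ≤ x) : 0 ≤ rho x :=
  integral_nonneg zero_le_one fun y _ =>
    mul_nonneg (mul_nonneg hx (exp_pos _).le) (angle_nonneg y)

theorem integral_kern {t : ℝ} (ht : 0 < t) :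
    ∫ v in 0..t, ∫ u in 0..t, ∫ w in 0..t, kern v u w = ∫ x in 0..t, phi x := by
  have hcube := lintegral_cube (F := fun v u w => ENNReal.ofReal (kern v u w))
    measurable_kern.ennreal_ofReal t
  have hpos : ∀ x ∈ Ioo 0 t, 0 ≤ phi x := by
    intro x hx
    have h1 := (lintegral_kern_first hx.1).1
    have h2 := rho_nonneg hx.1.le
    have h3 : 0 ≤ x * dawson x ^ 2 := mul_nonneg hx.1.le (sq_nonneg _)
    unfold phi
    linarith
  have h : ∫⁻ v in Ioo 0 t, ∫⁻ u in Ioo 0 t, ∫⁻ w in Ioo 0 t, ENNReal.ofReal (kern v u w)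
      = ENNReal.ofReal (∫ x in 0..t, phi x) := by
    rw [hcube, integral_of_le ht.le, integral_Ioc_eq_integral_Ioo,
      ofReal_integral_eq_lintegral_ofReal]
    · refine setLIntegral_congr_fun measurableSet_Ioo fun x hx => ?_
      obtain ⟨h1, h2⟩ := lintegral_kern_first hx.1
      simp only [h2, lintegral_kern_middle hx.1, lintegral_kern_last hx.1]
      rw [← ENNReal.ofReal_add (rho_nonneg hx.1.le) (mul_nonneg hx.1.le (sq_nonneg _)),
        ← ENNReal.ofReal_add h1
          (add_nonneg (rho_nonneg hx.1.le) (mul_nonneg hx.1.le (sq_nonneg _))), phi]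
      congr 1
      ring
    · exact continuous_phi.continuousOn.integrableOn_Icc.mono_set Ioo_subset_Icc_self
    · exact (ae_restrict_iff' measurableSet_Ioo).2 (Filter.Eventually.of_forall hpos)
  rw [integral_integral_integral_eq_toReal measurable_kern kern_nonneg ht.le
    (h ▸ ENNReal.ofReal_ne_top), h,
    ENNReal.toReal_ofReal]
  rw [integral_of_le ht.le, integral_Ioc_eq_integral_Ioo]
  exact setIntegral_nonneg measurableSet_Ioo hpos

theorem rpow_neg_half {x : ℝ} (hx : 0 ≤ x) : x ^ (-(1 / 2) : ℝ) = (√x)⁻¹ := by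
  rw [rpow_neg hx, sqrt_eq_rpow]

theorem integral_comp_const_sub (f : ℝ → ℝ) (t : ℝ) :
    ∫ s in 0..t, f s = ∫ u in 0..t, f (t - u) := by
  simp

theorem exp_mul_integral_eq {t : ℝ} (ht : 0 < t) :
    exp (-t) * ∫ t₂ in (0:ℝ)..t, ∫ s₁ in (0:ℝ)..t, ∫ s₂ in (0:ℝ)..t,
      exp (s₁ - |t₂ - s₂|) * (t - t₂) ^ (-(1 / 2) : ℝ) * |s₁ - s₂| ^ (-(1 / 2) : ℝ)
      = ∫ x in 0..t, phi x := by
  rw [← integral_kern ht, integral_comp_const_sub, ← intervalIntegral.integral_const_mul]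
  refine integral_congr fun v hv => ?_
  rw [uIcc_of_le ht.le] at hv
  rw [integral_comp_const_sub, ← intervalIntegral.integral_const_mul]
  refine integral_congr fun u _ => ?_
  rw [integral_comp_const_sub, ← intervalIntegral.integral_const_mul]
  refine integral_congr fun w _ => ?_
  have e1 : t - v - (t - w) = w - v := by ring
  have e2 : t - u - (t - w) = w - u := by ring
  have e3 : exp (t - u - |v - w|) = exp t * (exp (-u) * exp (-|v - w|)) := by
    rw [← exp_add, ← exp_add]; ring_nf
  have e4 : exp (-t) * exp t = 1 := by rw [← exp_add]; simp
  simp only [e1, e2, sub_sub_cancel, abs_sub_comm w, rpow_neg_half hv.1,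
    rpow_neg_half (abs_nonneg _), e3, kern]
  linear_combination (exp (-u) * exp (-|v - w|) * (√v)⁻¹ * (√|u - w|)⁻¹) * e4

theorem L2_eq {T : ℝ} (hT : 0 < T) : L2 (-(1 / 2)) T = ∫ x in 0..T, (T - x) * phi x := by
  have h1 : L2 (-(1 / 2)) T = ∫ t in 0..T, ∫ x in 0..t, phi x := by
    rw [L2, integral_of_le hT.le, integral_of_le hT.le]
    exact setIntegral_congr_fun measurableSet_Ioc fun t ht => exp_mul_integral_eq ht.1
  have hp := continuous_phi
  have h2 := integral_mul_deriv_eq_deriv_mul (a := 0) (b := T)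
    (u := fun t => ∫ x in 0..t, phi x) (v := fun t => t - T) (u' := phi) (v' := fun _ => 1)
    (fun t _ => (hp.integral_hasStrictDerivAt 0 t).hasDerivAt)
    (fun t _ => (hasDerivAt_id t).sub_const T) (hp.intervalIntegrable _ _)
    (continuous_const.intervalIntegrable _ _)
  simp only [mul_one, sub_self, mul_zero, integral_same, zero_mul, zero_sub] at h2
  rw [h1, h2, ← intervalIntegral.integral_neg]
  exact integral_congr fun x _ => by ring

noncomputable def dawsonIntegral (x : ℝ) : ℝ := ∫ t in (0:ℝ)..x, dawson t

theorem hasDerivAt_dawsonIntegral (x : ℝ) : HasDerivAt dawsonIntegral (dawson x) x :=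
  (continuous_dawson.integral_hasStrictDerivAt 0 x).hasDerivAt

theorem continuous_dawsonIntegral : Continuous dawsonIntegral :=
  continuous_iff_continuousAt.2 fun x => (hasDerivAt_dawsonIntegral x).continuousAt

theorem integral_sub_mul_phi_sub_rho {T : ℝ} (hT : 0 < T) :
    ∫ x in 0..T, (T - x) * (phi x - rho x)
      = 2 * (T - 1) * dawsonIntegral T - 2 * T - 1 + 3 * T * dawson T + T * dawson T ^ 2 / 4
        - T * gaussMean T ^ 2 / 4 + exp (-(2 * T)) + T * exp (-T) * gaussMean T := by
  have hE := continuous_dawsonIntegral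
  have hD := continuous_dawson
  have hN := continuous_gaussMean
  have hp := continuous_phi
  have hr := continuous_rho
  have hE0 : dawsonIntegral 0 = 0 := integral_same
  rw [integral_eq_sub_of_hasDerivAt_of_le (f := fun x =>
    T * (2 * dawsonIntegral x - x * dawson x ^ 2 / 2 - x * dawson x - x * exp (-x) * gaussMean x
      - exp (-(2 * x)))
    - (2 * dawsonIntegral x + 3 * x - 3 * x * dawson x - x * dawson x ^ 2 / 4
      - x ^ 2 * dawson x ^ 2 / 2 - x ^ 2 * dawson x - x ^ 2 * exp (-x) * gaussMean x
      + x * gaussMean x ^ 2 / 4 - x * exp (-x) * gaussMean x - (x + 1) * exp (-(2 * x)))) hT.le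
    (by fun_prop) ?_ (Continuous.intervalIntegrable (by fun_prop) _ _)]
  · simp only [hE0, mul_zero, neg_zero, exp_zero]
    ring
  · intro x hx
    have hx0 := hx.1
    have dE := hasDerivAt_dawsonIntegral x
    have dD := hasDerivAt_dawson hx0
    have dN := hasDerivAt_gaussMean hx0
    have d0 := hasDerivAt_id x
    have de : HasDerivAt (fun x : ℝ => exp (-x)) (-exp (-x)) x := by
      simpa using (hasDerivAt_neg x).exp
    have de2 : HasDerivAt (fun x : ℝ => exp (-(2 * x))) (-(2 * exp (-x) ^ 2)) x := by
      refine ((d0.const_mul 2).neg.exp).congr_deriv ?_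
      rw [← exp_nat_mul]
      simp only [Pi.neg_apply, id]
      push_cast
      ring_nf
    have dx2 := d0.pow 2
    have p1 := ((((dE.const_mul 2).sub ((d0.mul (dD.pow 2)).div_const 2)).sub (d0.mul dD)).sub
      ((d0.mul de).mul dN)).sub de2
    have p2 := ((((((((((dE.const_mul 2).add (d0.const_mul 3)).sub ((d0.const_mul 3).mul dD)).sub
      ((d0.mul (dD.pow 2)).div_const 4)).sub ((dx2.mul (dD.pow 2)).div_const 2)).sub
      (dx2.mul dD)).sub ((dx2.mul de).mul dN)).add ((d0.mul (dN.pow 2)).div_const 4)).sub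
      ((d0.mul de).mul dN)).sub ((d0.add_const 1).mul de2))
    have e : exp (-(2 * x)) = exp (-x) ^ 2 := by rw [← exp_nat_mul]; push_cast; ring_nf
    refine ((p1.const_mul T).sub p2).congr_deriv ?_
    simp only [Pi.mul_apply, Pi.pow_apply, id, phi, e, Nat.cast_ofNat]
    field_simp
    ring

theorem integral_sub_mul_mul_exp (T : ℝ) {l : ℝ} (hl : 0 < l) :
    ∫ x in 0..T, (T - x) * (x * exp (-(x * l)))
      = T / l ^ 2 - 2 / l ^ 3 + exp (-(T * l)) * (T / l ^ 2 + 2 / l ^ 3) := by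
  rw [integral_eq_sub_of_hasDerivAt (f := fun x => exp (-(x * l)) *
    (x ^ 2 / l - (T - 2 / l) * x / l - (T - 2 / l) / l ^ 2)) ?_
    (Continuous.intervalIntegrable (by fun_prop) _ _)]
  · simp only [zero_mul, neg_zero, exp_zero]
    field_simp
    ring
  · intro x _
    have d0 := hasDerivAt_id x
    have h := ((d0.mul_const l).neg.exp).mul
      ((((d0.pow 2).div_const l).sub ((d0.const_mul (T - 2 / l)).div_const l)).sub_const
        ((T - 2 / l) / l ^ 2))
    refine h.congr_deriv ?_
    simp only [id, Pi.pow_apply, Pi.neg_apply, Pi.sub_apply]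
    field_simp
    ring

theorem integral_angle_div_sq : ∫ y in (0:ℝ)..1, angle y / (1 + y) ^ 2 = π - 1 := by
  have hc : ContinuousOn angle (Icc 0 1) := continuousOn_angle.mono Icc_subset_Ici_self
  rw [integral_eq_sub_of_hasDerivAt_of_le (f := fun y =>
    -(angle y / (1 + y)) - 2 * √y / (1 + y) + angle y / 2) zero_le_one ?_ ?_ ?_]
  · norm_num [angle]
    ring
  · refine ContinuousOn.add (ContinuousOn.sub (ContinuousOn.neg (hc.div (by fun_prop) ?_))
      (ContinuousOn.div (by fun_prop) (by fun_prop) ?_)) (hc.div_const 2) <;>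
    · intro y hy
      have := hy.1
      positivity
  · intro y hy
    have hy0 := hy.1
    have hs := sqrt_pos.2 hy0
    have h5 : (√y) ^ 2 = y := sq_sqrt hy0.le
    have d0 := hasDerivAt_id y
    have da := hasDerivAt_angle hy
    have h1 : (1:ℝ) + y ≠ 0 := by positivity
    refine (((da.div (d0.const_add 1) h1).neg.sub
      (((hasDerivAt_sqrt hy0.ne').const_mul 2).div (d0.const_add 1) h1)).add
      (da.div_const 2)).congr_deriv ?_
    simp only [id]
    field_simp
    rw [h5]
    ring
  · refine ContinuousOn.intervalIntegrable ?_
    rw [uIcc_of_le zero_le_one]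
    refine hc.div (by fun_prop) fun y hy => ?_
    have := hy.1
    positivity

theorem integral_angle_div_cube :
    ∫ y in (0:ℝ)..1, 2 * angle y / (1 + y) ^ 3 = 11 * π / 8 - 1 := by
  have hc : ContinuousOn angle (Icc 0 1) := continuousOn_angle.mono Icc_subset_Ici_self
  rw [integral_eq_sub_of_hasDerivAt_of_le (f := fun y =>
    -(angle y / (1 + y) ^ 2) - √y / (1 + y) ^ 2 - 3 / 2 * (√y / (1 + y)) + 3 / 8 * angle y)
    zero_le_one ?_ ?_ ?_]
  · norm_num [angle]
    ring
  · refine ContinuousOn.add (ContinuousOn.sub (ContinuousOn.sub (ContinuousOn.neg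
      (hc.div (by fun_prop) ?_)) (ContinuousOn.div (by fun_prop) (by fun_prop) ?_))
      (continuousOn_const.mul (ContinuousOn.div (by fun_prop) (by fun_prop) ?_)))
      (continuousOn_const.mul hc) <;>
    · intro y hy
      have := hy.1
      positivity
  · intro y hy
    have hy0 := hy.1
    have hs := sqrt_pos.2 hy0
    have h5 : (√y) ^ 2 = y := sq_sqrt hy0.le
    have d1 := (hasDerivAt_id y).const_add 1
    have d2 := d1.pow 2
    have da := hasDerivAt_angle hy
    have ds := hasDerivAt_sqrt hy0.ne'
    have h1 : (1:ℝ) + y ≠ 0 := by positivity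
    have h2 : ((1:ℝ) + y) ^ 2 ≠ 0 := by positivity
    refine ((((da.div d2 h2).neg.sub (ds.div d2 h2)).sub ((ds.div d1 h1).const_mul (3 / 2))).add
      (da.const_mul (3 / 8))).congr_deriv ?_
    simp only [id, Pi.pow_apply]
    field_simp
    rw [h5]
    ring
  · refine ContinuousOn.intervalIntegrable ?_
    rw [uIcc_of_le zero_le_one]
    refine (continuousOn_const.mul hc).div (by fun_prop) fun y hy => ?_
    have := hy.1
    positivity

theorem integral_swap_of_continuous {F : ℝ → ℝ → ℝ} (hF : Continuous (Function.uncurry F))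
    {a b c d : ℝ} :
    ∫ x in a..b, ∫ y in c..d, F x y = ∫ y in c..d, ∫ x in a..b, F x y := by
  refine intervalIntegral_intervalIntegral_swap ?_
  exact (hF.continuousOn.integrableOn_compact (isCompact_uIcc.prod isCompact_uIcc)).mono_set
    (prod_mono uIoc_subset_uIcc uIoc_subset_uIcc)

theorem abs_integral_sub_mul_rho_le {T : ℝ} (hT : 0 < T) :
    |(∫ x in 0..T, (T - x) * rho x) - ((π - 1) * T - (11 * π / 8 - 1))|
      ≤ 2 * π * (exp (-T) * (T + 2)) := by
  have hc : ContinuousOn angle (Icc 0 1) := continuousOn_angle.mono Icc_subset_Ici_self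
  have hca : Continuous fun y : ℝ => angle (max y 0) :=
    continuousOn_angle.comp_continuous (by fun_prop) fun y => mem_Ici.2 (le_max_right _ _)
  have h1 : ∫ x in 0..T, (T - x) * rho x
      = ∫ x in 0..T, ∫ y in (0:ℝ)..1, (T - x) * (x * exp (-(x * (1 + y)))) * angle (max y 0) := by
    refine integral_congr fun x _ => ?_
    simp only [rho]
    rw [← intervalIntegral.integral_const_mul]
    refine integral_congr fun y hy => ?_
    rw [uIcc_of_le zero_le_one] at hy
    simp only [max_eq_left hy.1]
    ring
  have hcont : Continuous (Function.uncurry fun x y : ℝ =>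
      (T - x) * (x * exp (-(x * (1 + y)))) * angle (max y 0)) :=
    Continuous.mul (by fun_prop) (hca.comp continuous_snd)
  have h2 : ∫ x in 0..T, (T - x) * rho x = ∫ y in (0:ℝ)..1,
      (T * (angle y / (1 + y) ^ 2) - 2 * angle y / (1 + y) ^ 3
        + exp (-(T * (1 + y))) * (T / (1 + y) ^ 2 + 2 / (1 + y) ^ 3) * angle y) := by
    rw [h1, integral_swap_of_continuous hcont]
    refine integral_congr fun y hy => ?_
    rw [uIcc_of_le zero_le_one] at hy
    have hy0 : 0 < 1 + y := by linarith [hy.1]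
    simp only [max_eq_left hy.1]
    rw [intervalIntegral.integral_mul_const, integral_sub_mul_mul_exp T hy0]
    ring
  have hpos : ∀ y ∈ Icc (0:ℝ) 1, 1 + y ≠ 0 := fun y hy => by linarith [hy.1]
  have i1 : IntervalIntegrable (fun y => T * (angle y / (1 + y) ^ 2)) volume 0 1 := by
    refine ContinuousOn.intervalIntegrable ?_
    rw [uIcc_of_le zero_le_one]
    exact continuousOn_const.mul (hc.div (by fun_prop) fun y hy => pow_ne_zero _ (hpos y hy))
  have i2 : IntervalIntegrable (fun y => 2 * angle y / (1 + y) ^ 3) volume 0 1 := by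
    refine ContinuousOn.intervalIntegrable ?_
    rw [uIcc_of_le zero_le_one]
    exact (continuousOn_const.mul hc).div (by fun_prop) fun y hy => pow_ne_zero _ (hpos y hy)
  have i3 : IntervalIntegrable (fun y => exp (-(T * (1 + y))) *
      (T / (1 + y) ^ 2 + 2 / (1 + y) ^ 3) * angle y) volume 0 1 := by
    refine ContinuousOn.intervalIntegrable ?_
    rw [uIcc_of_le zero_le_one]
    refine ContinuousOn.mul (ContinuousOn.mul (by fun_prop) (ContinuousOn.add ?_ ?_)) hc
    · exact continuousOn_const.div (by fun_prop) fun y hy => pow_ne_zero _ (hpos y hy)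
    · exact continuousOn_const.div (by fun_prop) fun y hy => pow_ne_zero _ (hpos y hy)
  rw [h2, intervalIntegral.integral_add (i1.sub i2) i3, intervalIntegral.integral_sub i1 i2,
    intervalIntegral.integral_const_mul, integral_angle_div_sq, integral_angle_div_cube]
  have e : T * (π - 1) - (11 * π / 8 - 1) + (∫ y in (0:ℝ)..1, exp (-(T * (1 + y))) *
      (T / (1 + y) ^ 2 + 2 / (1 + y) ^ 3) * angle y) - ((π - 1) * T - (11 * π / 8 - 1))
      = ∫ y in (0:ℝ)..1, exp (-(T * (1 + y))) *
      (T / (1 + y) ^ 2 + 2 / (1 + y) ^ 3) * angle y := by ring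
  rw [e, ← Real.norm_eq_abs]
  refine (intervalIntegral.norm_integral_le_of_norm_le_const
    (C := 2 * π * (exp (-T) * (T + 2))) ?_).trans
    (by simp [abs_of_nonneg])
  intro y hy
  rw [uIoc_of_le zero_le_one] at hy
  have hy0 := hy.1
  have ha := angle_nonneg y
  have a1 : exp (-(T * (1 + y))) ≤ exp (-T) := exp_le_exp.2 (by nlinarith)
  have a2 : T / (1 + y) ^ 2 ≤ T := div_le_self hT.le (one_le_pow₀ (by linarith))
  have a3 : 2 / (1 + y) ^ 3 ≤ 2 := div_le_self (by norm_num) (one_le_pow₀ (by linarith))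
  rw [Real.norm_eq_abs, abs_of_nonneg (by positivity), mul_comm (2 * π)]
  gcongr
  exact angle_le y

theorem le_of_deriv_nonpos_of_tendsto {f f' : ℝ → ℝ} {a l : ℝ}
    (hd : ∀ x, a ≤ x → HasDerivAt f (f' x) x) (hf : ∀ x, a ≤ x → f' x ≤ 0)
    (ht : Tendsto f atTop (𝓝 l)) {x : ℝ} (hx : a ≤ x) : l ≤ f x := by
  have hanti : AntitoneOn f (Ici a) := by
    refine antitoneOn_of_deriv_nonpos (convex_Ici a)
      (fun x hx => (hd x hx).continuousAt.continuousWithinAt) ?_ ?_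
    · rw [interior_Ici]
      exact fun x hx => (hd x (le_of_lt hx)).differentiableAt.differentiableWithinAt
    · rw [interior_Ici]
      exact fun x hx => (hd x (le_of_lt hx)).deriv ▸ hf x (le_of_lt hx)
  refine le_of_tendsto ht ?_
  filter_upwards [eventually_ge_atTop x] with y hy using hanti hx (hx.trans hy) hy

theorem tendsto_sqrt_mul_gaussMean :
    Tendsto (fun x => √x * gaussMean x) atTop (𝓝 (√π)) := by
  have hi : IntegrableOn (fun r : ℝ => 2 * exp (-1 * r ^ 2)) (Ioi 0) :=
    ((integrable_exp_neg_mul_sq one_pos).const_mul 2).integrableOn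
  have h := (intervalIntegral_tendsto_integral_Ioi 0 hi tendsto_id).comp tendsto_sqrt_atTop
  have e : ∫ r in Ioi (0:ℝ), 2 * exp (-1 * r ^ 2) = √π := by
    rw [MeasureTheory.integral_const_mul, integral_gaussian_Ioi, div_one]
    ring
  rw [e] at h
  refine h.congr' ?_
  filter_upwards [eventually_ge_atTop 0] with x hx
  have := sqrt_mul_expSqMean (-1) x hx
  rw [neg_one_mul] at this
  exact this.symm

theorem abs_mul_gaussMean_sq_sub_pi_le {x : ℝ} (hx : 1 ≤ x) :
    |x * gaussMean x ^ 2 - π| ≤ 4 * exp (-x) := by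
  have hx0 : 0 < x := by linarith
  have hd : ∀ x : ℝ, 1 ≤ x → HasDerivAt (fun x => √x * gaussMean x) (exp (-x) * (√x)⁻¹) x := by
    intro x hx
    have h := hasDerivAt_sqrt_mul_expSqMean (-1) (x := x) (by linarith)
    simp only [neg_one_mul] at h
    exact h
  have he : ∀ x : ℝ, HasDerivAt (fun x : ℝ => exp (-x)) (-exp (-x)) x := fun x => by
    simpa using (hasDerivAt_neg x).exp
  have ht := tendsto_sqrt_mul_gaussMean
  have h1 : √π ≤ √x * gaussMean x + exp (-x) := by
    refine le_of_deriv_nonpos_of_tendsto (f := fun x => √x * gaussMean x + exp (-x)) (a := 1)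
      (fun x hx => (hd x hx).add (he x)) ?_ ?_ hx
    · intro x hx
      have : (√x)⁻¹ ≤ 1 := inv_le_one_of_one_le₀ (one_le_sqrt.2 hx)
      nlinarith [exp_pos (-x)]
    · simpa using ht.add (tendsto_exp_neg_atTop_nhds_zero)
  have h2 : -√π ≤ -(√x * gaussMean x) := by
    refine le_of_deriv_nonpos_of_tendsto (f := fun x => -(√x * gaussMean x)) (a := 1)
      (fun x hx => (hd x hx).neg) ?_ ht.neg hx
    intro x _
    have : 0 ≤ exp (-x) * (√x)⁻¹ := by positivity
    linarith
  have h0 : 0 ≤ √x * gaussMean x := mul_nonneg (sqrt_nonneg _) (expSqMean_nonneg _)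
  have hp : √π ^ 2 = π := sq_sqrt pi_pos.le
  have hp2 : √π ≤ 2 := by rw [sqrt_le_left (by norm_num)]; linarith [pi_le_four]
  have e : x * gaussMean x ^ 2 - π
      = -((√π - √x * gaussMean x) * (√π + √x * gaussMean x)) := by
    have := sq_sqrt hx0.le
    linear_combination (-gaussMean x ^ 2) * this + hp
  rw [e, abs_neg, abs_of_nonneg (mul_nonneg (by linarith) (by linarith [sqrt_nonneg π]))]
  calc _ ≤ exp (-x) * 4 := by
        refine mul_le_mul (by linarith) (by linarith) (by linarith [sqrt_nonneg π]) (exp_pos _).le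
    _ = _ := mul_comm _ _

theorem exp_neg_le {x : ℝ} (hx : 0 < x) : exp (-x) ≤ 24 / x ^ 4 := by
  have h := pow_div_factorial_le_exp x hx.le 4
  rw [exp_neg, inv_le_comm₀ (exp_pos _) (by positivity), inv_div]
  simpa [Nat.factorial] using h

/-- The error in the asymptotic expansion of `dawson`. -/
noncomputable def dawsonError (x : ℝ) : ℝ :=
  dawson x - (1 / x + 1 / (2 * x ^ 2) + 3 / (4 * x ^ 3))

theorem hasDerivAt_dawsonError {x : ℝ} (hx : 0 < x) :
    HasDerivAt dawsonError
      (15 / (8 * x ^ 4) - dawsonError x - dawsonError x / (2 * x)) x := by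
  have d0 := hasDerivAt_id x
  have h := (hasDerivAt_dawson hx).sub ((((hasDerivAt_const x (1:ℝ)).div d0 hx.ne').add
    ((hasDerivAt_const x (1:ℝ)).div ((d0.pow 2).const_mul 2) (by simp [hx.ne']))).add
    ((hasDerivAt_const x (3:ℝ)).div ((d0.pow 3).const_mul 4) (by simp [hx.ne'])))
  refine h.congr_deriv ?_
  simp only [id, Pi.pow_apply, dawsonError]
  field_simp
  ring

theorem exists_abs_dawsonError_le : ∃ C, 0 ≤ C ∧ ∀ x, 7 ≤ x → |dawsonError x| ≤ C / x ^ 4 := by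
  have hg : ∀ x : ℝ, 7 ≤ x → HasDerivAt (fun x => √x * exp x)
      (√x * exp x * (1 + 1 / (2 * x))) x := by
    intro x hx
    have hx0 : 0 < x := by linarith
    have hs := sqrt_pos.2 hx0
    have h4 : (√x) ^ 2 = x := sq_sqrt hx0.le
    refine ((hasDerivAt_sqrt hx0.ne').mul (Real.hasDerivAt_exp x)).congr_deriv ?_
    field_simp
    rw [h4]
    ring
  have hlow : ∀ x : ℝ, 7 ≤ x →
      √7 * exp 7 * dawsonError 7 ≤ √x * exp x * dawsonError x := by
    intro x hx
    refine le_of_hasDerivAt_nonneg (F := fun x => √x * exp x * dawsonError x)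
      (f := fun x => √x * exp x * (15 / (8 * x ^ 4))) hx ?_ ?_ ?_
    · intro y hy
      have hy0 : 0 < y := by linarith [hy.1]
      exact ((hg y hy.1).mul (hasDerivAt_dawsonError hy0)).continuousAt.continuousWithinAt
    · intro y hy
      have hy0 : 0 < y := by linarith [hy.1]
      refine ((hg y hy.1.le).mul (hasDerivAt_dawsonError hy0)).congr_deriv ?_
      field_simp
      ring
    · intro y hy
      positivity
  have hup : ∀ x : ℝ, 7 ≤ x → √x * exp x * (dawsonError x - 4 / x ^ 4)
      ≤ √7 * exp 7 * (dawsonError 7 - 4 / 7 ^ 4) := by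
    intro x hx
    have hd : ∀ y : ℝ, 7 ≤ y → HasDerivAt
        (fun x => -(√x * exp x * (dawsonError x - 4 / x ^ 4)))
        (√y * exp y * ((17 * y - 112) / (8 * y ^ 5))) y := by
      intro y hy
      have hy0 : 0 < y := by linarith
      have d4 := (hasDerivAt_const y (4:ℝ)).div ((hasDerivAt_id y).pow 4) (by simp [hy0.ne'])
      refine ((hg y hy).mul ((hasDerivAt_dawsonError hy0).sub d4)).neg.congr_deriv ?_
      simp only [id, Pi.pow_apply, Pi.sub_apply, Pi.div_apply]
      field_simp
      ring
    have := le_of_hasDerivAt_nonneg hx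
      (fun y hy => (hd y hy.1).continuousAt.continuousWithinAt) (fun y hy => hd y hy.1.le) ?_
    · linarith
    · intro y hy
      have hy0 : 0 < y := by linarith [hy.1]
      have : 0 ≤ 17 * y - 112 := by linarith [hy.1]
      positivity
  set K := |√7 * exp 7 * dawsonError 7| + |√7 * exp 7 * (dawsonError 7 - 4 / 7 ^ 4)| with hK
  have hK0 : 0 ≤ K := by positivity
  refine ⟨24 * K + 4, by positivity, fun x hx => ?_⟩
  have hx0 : 0 < x := by linarith
  have hg1 : 1 ≤ √x := one_le_sqrt.2 (by linarith)
  have hgpos : 0 < √x * exp x := by positivity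
  have hb : K / (√x * exp x) ≤ 24 * K / x ^ 4 := by
    have h1 : (√x * exp x)⁻¹ ≤ 24 / x ^ 4 := by
      refine le_trans ?_ (exp_neg_le hx0)
      rw [exp_neg]
      exact inv_anti₀ (exp_pos _) (le_mul_of_one_le_left (exp_pos _).le hg1)
    calc K / (√x * exp x) = K * (√x * exp x)⁻¹ := div_eq_mul_inv _ _
      _ ≤ K * (24 / x ^ 4) := by gcongr
      _ = _ := by ring
  have h1 : -(K / (√x * exp x)) ≤ dawsonError x := by
    rw [neg_le, le_div_iff₀ hgpos]
    have := hlow x hx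
    have := neg_abs_le (√7 * exp 7 * dawsonError 7)
    have := abs_nonneg (√7 * exp 7 * (dawsonError 7 - 4 / 7 ^ 4))
    linarith
  have h2 : dawsonError x - 4 / x ^ 4 ≤ K / (√x * exp x) := by
    rw [le_div_iff₀ hgpos]
    have := hup x hx
    have := le_abs_self (√7 * exp 7 * (dawsonError 7 - 4 / 7 ^ 4))
    have := abs_nonneg (√7 * exp 7 * dawsonError 7)
    linarith
  have h3 : 0 ≤ 4 / x ^ 4 := by positivity
  rw [add_div, abs_le]
  constructor <;> linarith

theorem integral_exp_neg_mul_log :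
    ∫ t in Ioi (0:ℝ), log t * exp (-t) = -eulerMascheroniConstant := by
  have h := Complex.hasDerivAt_GammaIntegral (s := 1) (by simp)
  have h2 : HasDerivAt Complex.GammaIntegral (-(eulerMascheroniConstant : ℂ)) 1 := by
    refine Complex.hasDerivAt_Gamma_one.congr_of_eventuallyEq ?_
    have : ∀ᶠ s : ℂ in 𝓝 1, 0 < s.re :=
      (isOpen_lt continuous_const Complex.continuous_re).mem_nhds (by simp)
    filter_upwards [this] with s hs using (Complex.Gamma_eq_integral hs).symm
  have h3 := h.unique h2
  simp only [sub_self, Complex.cpow_zero, one_mul] at h3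
  have h4 : ((∫ t in Ioi (0:ℝ), log t * exp (-t) : ℝ) : ℂ)
      = ((-eulerMascheroniConstant : ℝ) : ℂ) := by
    rw [← integral_complex_ofReal, Complex.ofReal_neg, ← h3]
    simp
  exact_mod_cast h4

theorem integrableOn_log_mul_exp_neg : IntegrableOn (fun t => log t * exp (-t)) (Ioi 0) := by
  refine Integrable.of_integral_ne_zero ?_
  rw [integral_exp_neg_mul_log]
  have := one_half_lt_eulerMascheroniConstant
  linarith

/-- `∫₀¹ 2 s exp(-x(1 - s²)) ds`, the continuous extension of `(1 - exp(-x)) / x`. -/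
noncomputable def expMean (x : ℝ) : ℝ := ∫ s in (0:ℝ)..1, 2 * s * exp (-(x * (1 - s ^ 2)))

theorem continuous_expMean : Continuous expMean := by
  unfold expMean
  exact continuous_parametric_intervalIntegral_of_continuous' (by fun_prop) 0 1

theorem mul_expMean (x : ℝ) : x * expMean x = 1 - exp (-x) := by
  rw [expMean, ← intervalIntegral.integral_const_mul, integral_eq_sub_of_hasDerivAt
    (f := fun s => exp (-(x * (1 - s ^ 2)))) ?_ (Continuous.intervalIntegrable (by fun_prop) _ _)]
  · simp
  · intro s _
    have h := ((((hasDerivAt_id s).pow 2).const_sub 1).const_mul x).neg.exp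
    refine h.congr_deriv ?_
    simp only [id, Pi.pow_apply, Pi.neg_apply]
    push_cast
    ring

theorem tendsto_integral_expMean :
    Tendsto (fun T => (∫ x in 0..T, expMean x) - log T) atTop (𝓝 eulerMascheroniConstant) := by
  have hm := continuous_expMean
  have hF : ∀ T : ℝ, 0 < T → ∫ x in 0..T, log x * exp (-x)
      = (1 - exp (-T)) * log T - ∫ x in 0..T, expMean x := by
    intro T hT
    have hml := Real.continuous_mul_log
    have hI : Continuous fun T => ∫ x in 0..T, expMean x :=
      continuous_primitive (fun a b => hm.intervalIntegrable a b) 0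
    rw [integral_eq_sub_of_hasDerivAt_of_le
      (f := fun T => expMean T * (T * log T) - ∫ x in 0..T, expMean x) hT.le
      ((hm.mul hml).sub hI).continuousOn ?_ ?_]
    · simp only [integral_same, zero_mul, mul_zero, sub_zero, ← mul_expMean]
      ring
    · intro x hx
      have hx0 := hx.1
      have he : HasDerivAt (fun x : ℝ => exp (-x)) (-exp (-x)) x := by
        simpa using (hasDerivAt_neg x).exp
      have h1 : HasDerivAt (fun T => (1 - exp (-T)) * log T - ∫ x in 0..T, expMean x) _ x :=
        ((he.const_sub 1).mul (hasDerivAt_log hx0.ne')).sub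
          (hm.integral_hasStrictDerivAt 0 x).hasDerivAt
      have h2 : (fun T => expMean T * (T * log T) - ∫ x in 0..T, expMean x)
          = fun T => (1 - exp (-T)) * log T - ∫ x in 0..T, expMean x := by
        funext T
        rw [← mul_expMean]; ring
      rw [h2]
      refine h1.congr_deriv ?_
      rw [← mul_expMean]
      field_simp
      ring
    · exact intervalIntegrable_log'.mul_continuousOn (by fun_prop)
  have h1 := intervalIntegral_tendsto_integral_Ioi 0 integrableOn_log_mul_exp_neg tendsto_id
  rw [integral_exp_neg_mul_log] at h1
  have h2 : Tendsto (fun T => exp (-T) * log T) atTop (𝓝 0) := by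
    have h3 : Tendsto (fun T : ℝ => T ^ 1 * exp (-T)) atTop (𝓝 0) :=
      tendsto_pow_mul_exp_neg_atTop_nhds_zero 1
    refine squeeze_zero' ?_ ?_ h3
    · filter_upwards [eventually_ge_atTop 1] with T hT using
        mul_nonneg (exp_pos _).le (log_nonneg hT)
    · filter_upwards [eventually_ge_atTop 1] with T hT
      rw [pow_one, mul_comm]
      exact mul_le_mul_of_nonneg_right (log_le_self (by linarith)) (exp_pos _).le
  have h4 := h1.neg.sub h2
  rw [neg_neg, sub_zero] at h4
  refine h4.congr' ?_
  filter_upwards [eventually_gt_atTop 0] with T hT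
  simp only [id, hF T hT]
  ring

theorem dawsonIntegral_eq (T : ℝ) :
    dawsonIntegral T = (∫ x in 0..T, expMean x) + 2 * log 2
      - ∫ s in (0:ℝ)..1, 2 / (1 + s) * exp (-(T * (1 - s ^ 2))) := by
  have hc : Continuous (Function.uncurry
      fun t s : ℝ => 2 * (1 - s) * exp (-(t * (1 - s ^ 2)))) := by
    unfold Function.uncurry
    fun_prop
  have h1 : ∀ x, dawson x = expMean x
      + ∫ s in (0:ℝ)..1, 2 * (1 - s) * exp (-(x * (1 - s ^ 2))) := by
    intro x
    rw [dawson, expSqMean, expMean, ← intervalIntegral.integral_const_mul,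
      ← intervalIntegral.integral_add (Continuous.intervalIntegrable (by fun_prop) _ _)
        (Continuous.intervalIntegrable (by fun_prop) _ _)]
    refine integral_congr fun s _ => ?_
    have : exp (-(x * (1 - s ^ 2))) = exp (-x) * exp (x * s ^ 2) := by rw [← exp_add]; ring_nf
    simp only [this]
    ring
  have hne : ∀ s ∈ uIcc (0:ℝ) 1, 1 + s ≠ 0 := by
    intro s hs
    rw [uIcc_of_le zero_le_one] at hs
    linarith [hs.1]
  have hi1 : IntervalIntegrable (fun s : ℝ => 2 / (1 + s)) volume 0 1 :=
    ContinuousOn.intervalIntegrable (continuousOn_const.div (by fun_prop) hne)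
  have h2 : ∀ s ∈ uIcc (0:ℝ) 1, ∫ t in 0..T, 2 * (1 - s) * exp (-(t * (1 - s ^ 2)))
      = 2 / (1 + s) - 2 / (1 + s) * exp (-(T * (1 - s ^ 2))) := by
    intro s hs
    have hs1 := hne s hs
    rw [integral_eq_sub_of_hasDerivAt (f := fun t => -(2 / (1 + s) * exp (-(t * (1 - s ^ 2))))) ?_
      (Continuous.intervalIntegrable (by fun_prop) _ _)]
    · simp
      ring
    · intro t _
      have h := (((((hasDerivAt_id t).mul_const (1 - s ^ 2)).neg).exp).const_mul (2 / (1 + s))).neg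
      refine h.congr_deriv ?_
      simp only [id, Pi.neg_apply]
      field_simp
      ring
  have h3 : ∫ s in (0:ℝ)..1, 2 / (1 + s) = 2 * log 2 := by
    rw [integral_eq_sub_of_hasDerivAt (f := fun s => 2 * log (1 + s)) ?_ hi1]
    · norm_num
    · intro s hs
      refine ((((hasDerivAt_id s).const_add 1).log (hne s hs)).const_mul 2).congr_deriv ?_
      simp only [id]
      ring
  rw [dawsonIntegral, funext h1, intervalIntegral.integral_add
    (continuous_expMean.intervalIntegrable _ _)
    ((continuous_parametric_intervalIntegral_of_continuous' hc 0 1).intervalIntegrable _ _),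
    integral_swap_of_continuous hc, integral_congr h2,
    intervalIntegral.integral_sub hi1 (hi1.mul_continuousOn (by fun_prop)), h3]
  ring

theorem tendsto_dawsonIntegral_sub_log :
    Tendsto (fun T => dawsonIntegral T - log T) atTop
      (𝓝 (2 * log 2 + eulerMascheroniConstant)) := by
  have h1 : Tendsto (fun T : ℝ => ∫ s in (0:ℝ)..1, 2 / (1 + s) * exp (-(T * (1 - s ^ 2)))) atTop
      (𝓝 (∫ _ in (0:ℝ)..1, (0:ℝ))) := by
    refine tendsto_integral_filter_of_dominated_convergence (fun _ => 2) ?_ ?_ ?_ ?_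
    · exact Eventually.of_forall fun T => Measurable.aestronglyMeasurable (by fun_prop)
    · filter_upwards [eventually_ge_atTop 0] with T hT
      refine Eventually.of_forall fun s hs => ?_
      rw [uIoc_of_le zero_le_one] at hs
      have hs0 := hs.1
      rw [Real.norm_eq_abs, abs_of_nonneg (by positivity)]
      have a1 : 2 / (1 + s) ≤ 2 := div_le_self (by norm_num) (by linarith)
      have a2 : exp (-(T * (1 - s ^ 2))) ≤ 1 := by
        rw [exp_le_one_iff, neg_nonpos]
        exact mul_nonneg hT (by nlinarith [hs.2])
      calc _ ≤ 2 * (1:ℝ) := mul_le_mul a1 a2 (exp_pos _).le (by norm_num)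
        _ = 2 := mul_one 2
    · exact continuous_const.intervalIntegrable _ _
    · have hne : ∀ᵐ s : ℝ, s ≠ 1 := by simp [ae_iff]
      filter_upwards [hne] with s hs hs'
      rw [uIoc_of_le zero_le_one] at hs'
      have hs1 : 0 < 1 - s ^ 2 := by
        have : s < 1 := lt_of_le_of_ne hs'.2 hs
        nlinarith [hs'.1]
      have := (tendsto_exp_neg_atTop_nhds_zero.comp
        (tendsto_id.atTop_mul_const hs1)).const_mul (2 / (1 + s))
      simpa using this
  rw [intervalIntegral.integral_zero] at h1
  have h2 := (tendsto_integral_expMean.const_add (2 * log 2)).sub h1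
  rw [sub_zero] at h2
  refine h2.congr fun T => ?_
  rw [dawsonIntegral_eq]
  ring

theorem exists_abs_dawsonIntegral_sub_le : ∃ C, 0 ≤ C ∧ ∀ x, 7 ≤ x →
    |dawsonIntegral x - (log x + (2 * log 2 + eulerMascheroniConstant)
      - 1 / (2 * x) - 3 / (8 * x ^ 2))| ≤ C / x ^ 3 := by
  obtain ⟨C, hC, hb⟩ := exists_abs_dawsonError_le
  refine ⟨C, hC, fun x hx => ?_⟩
  set c := 2 * log 2 + eulerMascheroniConstant
  have hd : ∀ y : ℝ, 7 ≤ y → HasDerivAt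
      (fun y => dawsonIntegral y - log y + 1 / (2 * y) + 3 / (8 * y ^ 2)) (dawsonError y) y := by
    intro y hy
    have hy0 : 0 < y := by linarith
    have d0 := hasDerivAt_id y
    have h := (((hasDerivAt_dawsonIntegral y).sub (hasDerivAt_log hy0.ne')).add
      ((hasDerivAt_const y (1:ℝ)).div (d0.const_mul 2) (by simp [hy0.ne']))).add
      ((hasDerivAt_const y (3:ℝ)).div ((d0.pow 2).const_mul 8) (by simp [hy0.ne']))
    refine h.congr_deriv ?_
    simp only [id, Pi.pow_apply, dawsonError]
    field_simp
    ring
  have hdC : ∀ y : ℝ, 7 ≤ y → HasDerivAt (fun y => C / y ^ 3) (-(3 * (C / y ^ 4))) y := by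
    intro y hy
    have hy0 : 0 < y := by linarith
    refine ((hasDerivAt_const y C).div ((hasDerivAt_id y).pow 3) (by simp [hy0.ne'])).congr_deriv ?_
    simp only [id, Pi.pow_apply]
    field_simp
    ring
  have t1 : Tendsto (fun y : ℝ => 1 / (2 * y)) atTop (𝓝 0) :=
    (tendsto_id.const_mul_atTop two_pos).const_div_atTop 1
  have t2 : Tendsto (fun y : ℝ => 3 / (8 * y ^ 2)) atTop (𝓝 0) :=
    ((tendsto_pow_atTop two_ne_zero).const_mul_atTop (by norm_num)).const_div_atTop 3
  have t3 : Tendsto (fun y : ℝ => C / y ^ 3) atTop (𝓝 0) :=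
    (tendsto_pow_atTop three_ne_zero).const_div_atTop C
  have ht : Tendsto (fun y => dawsonIntegral y - log y + 1 / (2 * y) + 3 / (8 * y ^ 2)) atTop
      (𝓝 c) := by
    simpa using (tendsto_dawsonIntegral_sub_log.add t1).add t2
  have hCn : ∀ y : ℝ, 7 ≤ y → 0 ≤ C / y ^ 4 := fun y hy => by positivity
  have h1 := le_of_deriv_nonpos_of_tendsto (fun y hy => (hd y hy).add (hdC y hy))
    (fun y hy => by linarith [(abs_le.1 (hb y hy)).2, hCn y hy]) (ht.add t3) hx
  have h2 := le_of_deriv_nonpos_of_tendsto (fun y hy => (hd y hy).neg.add (hdC y hy))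
    (fun y hy => by linarith [(abs_le.1 (hb y hy)).1, hCn y hy]) (ht.neg.add t3) hx
  simp only [Pi.add_apply, Pi.neg_apply] at h1 h2
  rw [abs_le]
  constructor <;> linarith

theorem abs_expansion_remainder_le {T η δ N E F r q C₁ C₂ : ℝ} (hT : 7 ≤ T) (hC₁ : 0 ≤ C₁)
    (hη : |η| ≤ C₂ / T ^ 3) (hδ : |δ| ≤ C₁ / T ^ 4) (hE₀ : 0 ≤ E)
    (hE : E ≤ 24 / T ^ 4) (hF₀ : 0 ≤ F) (hF : F ≤ E) (hN₀ : 0 ≤ N) (hN : N ≤ 2)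
    (hq : |q| ≤ 4 * E) (hr : |r| ≤ 8 * (E * (T + 2))) :
    |2 * (T - 1) * (-(1 / (2 * T)) - 3 / (8 * T ^ 2) + η)
      + 3 * T * (1 / T + 1 / (2 * T ^ 2) + 3 / (4 * T ^ 3) + δ)
      + T * (1 / T + 1 / (2 * T ^ 2) + 3 / (4 * T ^ 3) + δ) ^ 2 / 4 - 2 - 2 / T
      - q / 4 + F + T * E * N + r|
    ≤ (2 * C₂ + 5 * C₁ + C₁ ^ 2 + 700) * (1 / T) ^ 2 := by
  have hT0 : 0 < T := by linarith
  obtain ⟨u, hu⟩ : ∃ u, u = 1 / T := ⟨_, rfl⟩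
  have hu0 : 0 < u := hu ▸ by positivity
  have hTu : T * u = 1 := by rw [hu]; field_simp
  have hu1 : u ≤ 1 := by
    rw [hu, div_le_one hT0]; linarith
  have hp3 : u ^ 3 ≤ u ^ 2 := pow_le_pow_of_le_one hu0.le hu1 (by norm_num)
  have hp4 : u ^ 4 ≤ u ^ 2 := pow_le_pow_of_le_one hu0.le hu1 (by norm_num)
  have hp5 : u ^ 5 ≤ u ^ 2 := pow_le_pow_of_le_one hu0.le hu1 (by norm_num)
  have hp7 : u ^ 7 ≤ u ^ 2 := pow_le_pow_of_le_one hu0.le hu1 (by norm_num)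
  have hη' : |η| ≤ C₂ * u ^ 3 := by rw [hu]; convert hη using 1; field_simp
  have hδ' : |δ| ≤ C₁ * u ^ 4 := by rw [hu]; convert hδ using 1; field_simp
  have hE' : E ≤ 24 * u ^ 4 := by rw [hu]; convert hE using 1; field_simp
  have h₁ : |2 * (T - 1) * η| ≤ 2 * C₂ * u ^ 2 := by
    rw [abs_mul, abs_of_nonneg (by linarith : 0 ≤ 2 * (T - 1))]
    calc 2 * (T - 1) * |η| ≤ 2 * T * (C₂ * u ^ 3) := by gcongr; linarith
      _ = 2 * C₂ * u ^ 2 * (T * u) := by ring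
      _ = _ := by rw [hTu, mul_one]
  have h₂ : |3 * T * δ| ≤ 3 * C₁ * u ^ 2 := by
    rw [abs_mul, abs_of_nonneg (by linarith : 0 ≤ 3 * T)]
    calc 3 * T * |δ| ≤ 3 * T * (C₁ * u ^ 4) := by gcongr
      _ = 3 * C₁ * u ^ 3 * (T * u) := by ring
      _ = 3 * C₁ * u ^ 3 := by rw [hTu, mul_one]
      _ ≤ _ := by gcongr
  have h₃ : |(1 + u / 2 + 3 / 4 * u ^ 2) * δ / 2| ≤ 2 * C₁ * u ^ 2 := by
    have ha : 0 ≤ 1 + u / 2 + 3 / 4 * u ^ 2 := by positivity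
    have hb : 1 + u / 2 + 3 / 4 * u ^ 2 ≤ 4 := by nlinarith
    rw [abs_div, abs_mul, abs_of_nonneg ha, abs_two]
    calc (1 + u / 2 + 3 / 4 * u ^ 2) * |δ| / 2 ≤ 4 * (C₁ * u ^ 4) / 2 := by gcongr
      _ = 2 * C₁ * u ^ 4 := by ring
      _ ≤ _ := by gcongr
  have h₄ : |T * δ ^ 2 / 4| ≤ C₁ ^ 2 * u ^ 2 := by
    rw [abs_of_nonneg (by positivity), ← sq_abs δ]
    calc T * |δ| ^ 2 / 4 ≤ T * (C₁ * u ^ 4) ^ 2 / 4 := by gcongr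
      _ = C₁ ^ 2 * u ^ 7 * (T * u) / 4 := by ring
      _ ≤ C₁ ^ 2 * u ^ 7 := by
        rw [hTu, mul_one]
        exact div_le_self (by positivity) (by norm_num)
      _ ≤ _ := by gcongr
  have h₅ : |T * E * N| ≤ 48 * u ^ 2 := by
    rw [abs_of_nonneg (by positivity)]
    calc T * E * N ≤ T * (24 * u ^ 4) * 2 := by gcongr
      _ = 48 * u ^ 3 * (T * u) := by ring
      _ ≤ _ := by rw [hTu, mul_one]; gcongr
  have h₆ : |r| ≤ 576 * u ^ 2 := by
    refine hr.trans ?_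
    calc 8 * (E * (T + 2)) ≤ 8 * (24 * u ^ 4 * (T + 2)) := by gcongr
      _ = 192 * u ^ 3 * (T * u) + 384 * u ^ 4 := by ring
      _ ≤ _ := by rw [hTu, mul_one]; linarith
  have key : 2 * (T - 1) * (-(1 / (2 * T)) - 3 / (8 * T ^ 2) + η)
      + 3 * T * (1 / T + 1 / (2 * T ^ 2) + 3 / (4 * T ^ 3) + δ)
      + T * (1 / T + 1 / (2 * T ^ 2) + 3 / (4 * T ^ 3) + δ) ^ 2 / 4 - 2 - 2 / T
      - q / 4 + F + T * E * N + r
      = 2 * (T - 1) * η + 3 * T * δ + (1 + u / 2 + 3 / 4 * u ^ 2) * δ / 2 + T * δ ^ 2 / 4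
        + (13 / 4 * u ^ 2 + 7 / 16 * u ^ 3 + 3 / 16 * u ^ 4 + 9 / 64 * u ^ 5)
        - q / 4 + F + T * E * N + r := by
    rw [hu]; field_simp; ring
  rw [key, ← hu]
  have h₇ : 0 ≤ 13 / 4 * u ^ 2 + 7 / 16 * u ^ 3 + 3 / 16 * u ^ 4 + 9 / 64 * u ^ 5 := by
    positivity
  have h₈ : 13 / 4 * u ^ 2 + 7 / 16 * u ^ 3 + 3 / 16 * u ^ 4 + 9 / 64 * u ^ 5 ≤ 5 * u ^ 2 := by
    linarith [sq_nonneg u]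
  have hsum : (2 * C₂ + 5 * C₁ + C₁ ^ 2 + 700) * u ^ 2 = 2 * C₂ * u ^ 2 + 3 * C₁ * u ^ 2
      + 2 * C₁ * u ^ 2 + C₁ ^ 2 * u ^ 2 + 700 * u ^ 2 := by ring
  have hE'' : E ≤ 24 * u ^ 2 := hE'.trans (by gcongr)
  rw [hsum]
  generalize 2 * (T - 1) * η = x₁ at *
  generalize 3 * T * δ = x₂ at *
  generalize (1 + u / 2 + 3 / 4 * u ^ 2) * δ / 2 = x₃ at *
  generalize T * δ ^ 2 / 4 = x₄ at *
  generalize T * E * N = x₅ at *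
  generalize 13 / 4 * u ^ 2 + 7 / 16 * u ^ 3 + 3 / 16 * u ^ 4 + 9 / 64 * u ^ 5 = x₆ at *
  have hu2 := sq_nonneg u
  rw [abs_le] at h₁ h₂ h₃ h₄ h₅ h₆ hq ⊢
  clear key hsum
  constructor <;> linarith

theorem gaussMean_le_two {x : ℝ} (hx : 7 ≤ x) : gaussMean x ≤ 2 := by
  have h := (abs_le.1 (abs_mul_gaussMean_sq_sub_pi_le (by linarith : 1 ≤ x))).2
  have he : exp (-x) ≤ 1 := exp_le_one_iff.2 (by linarith)
  by_contra! hN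
  nlinarith [pi_lt_four]

theorem integral_sub_mul_phi_eq_add (T : ℝ) : ∫ x in (0 : ℝ)..T, (T - x) * phi x =
    (∫ x in (0 : ℝ)..T, (T - x) * (phi x - rho x)) + ∫ x in (0 : ℝ)..T, (T - x) * rho x := by
  have hc : Continuous fun x : ℝ => T - x := by fun_prop
  have hφ : IntervalIntegrable (fun x => (T - x) * (phi x - rho x)) volume 0 T :=
    (hc.mul (continuous_phi.sub continuous_rho)).intervalIntegrable _ _
  have hρ : IntervalIntegrable (fun x => (T - x) * rho x) volume 0 T :=
    (hc.mul continuous_rho).intervalIntegrable _ _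
  rw [← intervalIntegral.integral_add hφ hρ]
  exact intervalIntegral.integral_congr fun x _ => by ring

end

theorem stmt_18 :
    ∃ M cM : ℝ, ∀ T > cM,
      |L2 (-(1/2)) T -
        2 * ((T - 1) * Real.log T
          + ((2 * Real.log 2 + Real.eulerMascheroniConstant) + (π - 3) / 2) * T
          + 1 - (2 * Real.log 2 + Real.eulerMascheroniConstant) - 13 * π / 16 + 1 / T)|
        ≤ M * T ^ (-2 : ℝ) := by
  obtain ⟨C₁, hC₁, hδ⟩ := exists_abs_dawsonError_le
  obtain ⟨C₂, -, hη⟩ := exists_abs_dawsonIntegral_sub_le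
  refine ⟨2 * C₂ + 5 * C₁ + C₁ ^ 2 + 700, 7, fun T hT => ?_⟩
  have hT0 : 0 < T := by linarith
  have hpow : T ^ (-2 : ℝ) = (1 / T) ^ 2 := by
    rw [rpow_neg hT0.le, rpow_two, one_div, inv_pow]
  have hr : |(∫ x in (0 : ℝ)..T, (T - x) * rho x) - ((π - 1) * T - (11 * π / 8 - 1))|
      ≤ 8 * (exp (-T) * (T + 2)) := by
    refine (abs_integral_sub_mul_rho_le hT0).trans ?_
    gcongr
    linarith [pi_lt_four]
  have h := abs_expansion_remainder_le hT.le hC₁ (hη T hT.le) (hδ T hT.le)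
    (exp_pos (-T)).le (exp_neg_le hT0) (exp_pos (-(2 * T))).le (exp_le_exp.2 (by linarith))
    (expSqMean_nonneg (-T)) (gaussMean_le_two hT.le)
    (abs_mul_gaussMean_sq_sub_pi_le (by linarith : 1 ≤ T)) hr
  rw [hpow]
  convert h using 2
  rw [L2_eq hT0, integral_sub_mul_phi_eq_add, integral_sub_mul_phi_sub_rho hT0, dawsonError]
  change _ = _ + T * exp (-T) * gaussMean T + _
  ring
end

section
/- Let β ∈ (−1, 0). Then for every γ > 0, T^γ · (∫_{[0,T]²} e^{−z−x} x^β z^β (T − x − z − 1/2) dx dz − (1/2)·Γ(1+β)²·(2T − 4β − 5)) → 0 as T → ∞; that is, ∫_{[0,T]²} e^{−z−x} x^β z^β (T − x − z − 1/2) dx dz = (1/2)·Γ(1+β)²·(2T − 4β − 5) + o(T^{−γ}) for every γ > 0. -/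
open Real MeasureTheory intervalIntegral

theorem Gamma_sub_intervalIntegral_eq {s : ℝ} (hs : 0 < s) {T : ℝ} (hT : 0 ≤ T) :
    Real.Gamma s - ∫ x in (0:ℝ)..T, Real.exp (-x) * x ^ (s - 1) =
      ∫ x in Set.Ioi T, Real.exp (-x) * x ^ (s - 1) := by
  have h := Real.GammaIntegral_convergent hs
  rw [Real.Gamma_eq_integral hs, sub_eq_iff_eq_add']
  refine (integral_interval_add_Ioi h (h.mono_set ?_)).symm
  exact Set.Ioi_subset_Ioi hT

theorem tendsto_Gamma_sub_intervalIntegral {s : ℝ} (hs : 0 < s) :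
    Filter.Tendsto
      (fun T : ℝ => Real.Gamma s - ∫ x in (0:ℝ)..T, Real.exp (-x) * x ^ (s - 1))
      Filter.atTop (nhds 0) := by
  have h := intervalIntegral_tendsto_integral_Ioi 0 (Real.GammaIntegral_convergent hs)
    Filter.tendsto_id
  rw [← Real.Gamma_eq_integral hs] at h
  simpa using h.const_sub (Real.Gamma s)

theorem tendsto_rpow_mul_Gamma_sub_intervalIntegral {s γ : ℝ} (hs : 0 < s) (hγ : 0 ≤ γ) :
    Filter.Tendsto
      (fun T : ℝ => T ^ γ *
        (Real.Gamma s - ∫ x in (0:ℝ)..T, Real.exp (-x) * x ^ (s - 1)))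
      Filter.atTop (nhds 0) := by
  have hsγ : 0 < s + γ := by linarith
  refine tendsto_of_tendsto_of_tendsto_of_le_of_le' tendsto_const_nhds
    (tendsto_Gamma_sub_intervalIntegral hsγ) ?_ ?_
  · filter_upwards [Filter.eventually_gt_atTop 0] with T hT
    rw [Gamma_sub_intervalIntegral_eq hs hT.le]
    refine mul_nonneg (by positivity) (setIntegral_nonneg measurableSet_Ioi fun x hx => ?_)
    have hx0 : 0 < x := hT.trans hx
    positivity
  · filter_upwards [Filter.eventually_gt_atTop 0] with T hT
    rw [Gamma_sub_intervalIntegral_eq hs hT.le, Gamma_sub_intervalIntegral_eq hsγ hT.le,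
      ← MeasureTheory.integral_const_mul]
    have hsub : Set.Ioi T ⊆ Set.Ioi 0 := Set.Ioi_subset_Ioi hT.le
    refine setIntegral_mono_on
      (((Real.GammaIntegral_convergent hs).mono_set hsub).const_mul _)
      ((Real.GammaIntegral_convergent hsγ).mono_set hsub) measurableSet_Ioi fun x hx => ?_
    have hx0 : 0 < x := hT.trans hx
    have hpow : x ^ (s + γ - 1) = x ^ γ * x ^ (s - 1) := by
      rw [← Real.rpow_add hx0]; ring_nf
    rw [hpow, mul_left_comm]
    have hle : T ^ γ ≤ x ^ γ := Real.rpow_le_rpow hT.le (le_of_lt hx) hγ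
    gcongr

theorem intervalIntegrable_exp_neg_mul_rpow {s : ℝ} (hs : 0 < s) {T : ℝ} (hT : 0 ≤ T) :
    IntervalIntegrable (fun x : ℝ => Real.exp (-x) * x ^ (s - 1)) volume 0 T :=
  (intervalIntegrable_iff_integrableOn_Ioc_of_le hT).2
    ((Real.GammaIntegral_convergent hs).mono_set Set.Ioc_subset_Ioi_self)

theorem integral_integral_exp_mul_rpow_mul_affine {β : ℝ} (hβ : -1 < β) {T : ℝ} (hT : 0 ≤ T) :
    (∫ x in (0:ℝ)..T, ∫ z in (0:ℝ)..T,
        Real.exp (-z - x) * x ^ β * z ^ β * (T - x - z - 1/2)) =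
      (T - 1/2) * (∫ x in (0:ℝ)..T, Real.exp (-x) * x ^ (1 + β - 1)) ^ 2 -
        2 * (∫ x in (0:ℝ)..T, Real.exp (-x) * x ^ (1 + β - 1)) *
          ∫ x in (0:ℝ)..T, Real.exp (-x) * x ^ (2 + β - 1) := by
  have hA := intervalIntegrable_exp_neg_mul_rpow (s := 1 + β) (by linarith) hT
  have hB := intervalIntegrable_exp_neg_mul_rpow (s := 2 + β) (by linarith) hT
  set f : ℝ → ℝ := fun x => Real.exp (-x) * x ^ (1 + β - 1) with hf
  set g : ℝ → ℝ := fun x => Real.exp (-x) * x ^ (2 + β - 1) with hg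
  have hfg : ∀ x : ℝ, 0 < x → g x = f x * x := fun x hx => by
    have : x ^ (2 + β - 1) = x ^ (1 + β - 1) * x := by
      rw [← Real.rpow_add_one hx.ne']; ring_nf
    simp only [hf, hg, this, mul_assoc]
  have inner : ∀ x ∈ Set.Ioc 0 T, (∫ z in (0:ℝ)..T,
      Real.exp (-z - x) * x ^ β * z ^ β * (T - x - z - 1/2)) =
      f x * ((T - 1/2) * (∫ z in (0:ℝ)..T, f z) - ∫ z in (0:ℝ)..T, g z) -
        g x * ∫ z in (0:ℝ)..T, f z := fun x hx => by
    have : (∫ z in (0:ℝ)..T, Real.exp (-z - x) * x ^ β * z ^ β * (T - x - z - 1/2)) =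
        ∫ z in (0:ℝ)..T, ((f x * (T - 1/2) - g x) * f z - f x * g z) := by
      refine integral_congr_ae (Filter.Eventually.of_forall fun z hz => ?_)
      rw [Set.uIoc_of_le hT] at hz
      have he : Real.exp (-z - x) = Real.exp (-z) * Real.exp (-x) := by
        rw [← Real.exp_add]; ring_nf
      rw [hfg x hx.1, hfg z hz.1, he]
      simp only [hf, add_sub_cancel_left]
      ring
    rw [this, integral_sub (hA.const_mul _) (hB.const_mul _),
      intervalIntegral.integral_const_mul, intervalIntegral.integral_const_mul]
    ring
  have outer : (∫ x in (0:ℝ)..T, ∫ z in (0:ℝ)..T,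
      Real.exp (-z - x) * x ^ β * z ^ β * (T - x - z - 1/2)) =
      ∫ x in (0:ℝ)..T, (f x * ((T - 1/2) * (∫ z in (0:ℝ)..T, f z) - ∫ z in (0:ℝ)..T, g z) -
        g x * ∫ z in (0:ℝ)..T, f z) := by
    refine integral_congr_ae (Filter.Eventually.of_forall fun x hx => ?_)
    rw [Set.uIoc_of_le hT] at hx
    exact inner x hx
  rw [outer, integral_sub (hA.mul_const _) (hB.mul_const _),
    intervalIntegral.integral_mul_const, intervalIntegral.integral_mul_const]
  ring

theorem stmt_19 (β : ℝ) (hβ : β ∈ Set.Ioo (-1 : ℝ) 0) :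
    ∀ γ > (0 : ℝ),
      Filter.Tendsto
        (fun T : ℝ => T ^ γ *
          ((∫ x in (0:ℝ)..T, ∫ z in (0:ℝ)..T,
              Real.exp (-z - x) * x ^ β * z ^ β * (T - x - z - 1/2)) -
            (1/2) * (Real.Gamma (1 + β)) ^ 2 * (2 * T - 4 * β - 5)))
        Filter.atTop (nhds 0) := by
  intro γ hγ
  have h1 : 0 < 1 + β := by linarith [hβ.1]
  have h2 : 0 < 2 + β := by linarith
  have hGamma : Real.Gamma (2 + β) = (1 + β) * Real.Gamma (1 + β) := by
    rw [← Real.Gamma_add_one h1.ne']; ring_nf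
  have a0 := tendsto_Gamma_sub_intervalIntegral h1
  have b0 := tendsto_Gamma_sub_intervalIntegral h2
  have aγ := tendsto_rpow_mul_Gamma_sub_intervalIntegral h1 hγ.le
  have bγ := tendsto_rpow_mul_Gamma_sub_intervalIntegral h2 hγ.le
  have aγ1 := tendsto_rpow_mul_Gamma_sub_intervalIntegral h1 (γ := γ + 1) (by linarith)
  have hc := a0.sub_const (2 * Real.Gamma (1 + β))
  have key := ((((aγ1.mul hc).sub ((aγ.mul hc).const_mul (1/2))).add
    (aγ.const_mul (2 * Real.Gamma (2 + β)))).add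
      (bγ.const_mul (2 * Real.Gamma (1 + β)))).sub ((aγ.mul b0).const_mul 2)
  simp only [zero_mul, mul_zero, sub_zero, add_zero] at key
  refine key.congr' ?_
  filter_upwards [Filter.eventually_gt_atTop 0] with T hT
  rw [integral_integral_exp_mul_rpow_mul_affine hβ.1 hT.le, Real.rpow_add_one hT.ne', hGamma]
  ring
end
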